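/- arXiv:2204.13441 — 4 statements merged into one kernel-verified Lean document; each statement's English description precedes it below -/
import Mathlib

section
/- Let k > 2, N ≥ 2k and d ≥ 2, and suppose there exists a k-uniform state of N qudits with d levels having minimal support. Then there exist infinitely many pairwise non-SLOCC-equivalent (hence pairwise non-LU-equivalent) k-uniform states of N qudits with d levels: there is a family (ψ_θ)_{θ ∈ [0,π)} of k-uniform states of N qudits with d levels such that for all θ₁ ≠ θ₂ in [0,π), the states ψ_{θ₁} and ψ_{θ₂} are not SLOCC-equivalent. -/
open scoped ComplexConjugate

/-- Glue a function on `S` and a function on `Sᶜ` into a function on all parties. -/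
def glue {N d : ℕ} (S : Finset (Fin N)) (x : {i // i ∈ S} → Fin d)
    (z : {i // i ∈ Sᶜ} → Fin d) : Fin N → Fin d :=
  fun i => if h : i ∈ S then x ⟨i, h⟩ else z ⟨i, Finset.mem_compl.mpr h⟩

/-- Reduced density matrix of `ψ` on the subset `S` of parties. -/
noncomputable def rdm {N d : ℕ} (S : Finset (Fin N)) (ψ : (Fin N → Fin d) → ℂ) :
    Matrix ({i // i ∈ S} → Fin d) ({i // i ∈ S} → Fin d) ℂ :=
  fun x y => ∑ z : {i // i ∈ Sᶜ} → Fin d, ψ (glue S x z) * conj (ψ (glue S y z))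

/-- `ψ` is `k`-uniform: every `k`-party reduced density matrix is maximally mixed. -/
def IsKUniform (N d k : ℕ) (ψ : (Fin N → Fin d) → ℂ) : Prop :=
  ∀ S : Finset (Fin N), S.card = k →
    rdm S ψ = (((d : ℂ) ^ k)⁻¹) •
      (1 : Matrix ({i // i ∈ S} → Fin d) ({i // i ∈ S} → Fin d) ℂ)

/-- The support of a state: the set of basis labels with nonzero coefficient. -/
noncomputable def stateSupport {α : Type} [Fintype α] (ψ : α → ℂ) : Finset α :=
  @Finset.filter _ (fun x => ψ x ≠ 0) (Classical.decPred _) Finset.univ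

/-- Action of the local operator `O_1 ⊗ ⋯ ⊗ O_N` on a multipartite state. -/
noncomputable def applyLocal {ι α : Type} [Fintype ι] [DecidableEq ι] [Fintype α]
    [DecidableEq α] (O : ι → Matrix α α ℂ) (ψ : (ι → α) → ℂ) : (ι → α) → ℂ :=
  fun x => ∑ y : ι → α, (∏ i, O i (x i) (y i)) * ψ y

/-- A monomial matrix: exactly one nonzero entry in every row and every column. -/
def IsMonomial {α : Type} [Fintype α] (M : Matrix α α ℂ) : Prop :=
  (∀ i, ∃! j, M i j ≠ 0) ∧ (∀ j, ∃! i, M i j ≠ 0)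

/-- Every word of `D` has its letters in the alphabets `X`, and any `k` coordinates of a word of
`D` can be prescribed freely and determine it. -/
def IsMDSOn {ι α : Type} (k : ℕ) (D : Finset (ι → α)) (X : ι → Finset α) : Prop :=
  (∀ x ∈ D, ∀ i, x i ∈ X i) ∧ ∀ T : Finset ι, T.card = k → ∀ t : ι → α,
    (∀ i ∈ T, t i ∈ X i) → ∃! x, x ∈ D ∧ ∀ i ∈ T, x i = t i

section Combinatorics

variable {ι α : Type}

theorem IsMDSOn.eq_of_agree {k : ℕ} {D : Finset (ι → α)} {X : ι → Finset α}
    (h : IsMDSOn k D X) {T : Finset ι} (hT : k ≤ T.card) {x y : ι → α} (hx : x ∈ D) (hy : y ∈ D)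
    (hxy : ∀ i ∈ T, x i = y i) : x = y := by
  obtain ⟨T', hT', hc⟩ := Finset.exists_subset_card_eq hT
  exact (h.2 T' hc y fun i _ => h.1 y hy i).unique ⟨hx, fun i hi => hxy i (hT' hi)⟩
    ⟨hy, fun i _ => rfl⟩

/-- A sign function on `D` that is odd under exchanging two letters at coordinate `e` sums to zero
over the words of `D` with a prescribed letter elsewhere. -/
theorem IsMDSOn.sum_eq_zero [Fintype ι] [DecidableEq ι] [DecidableEq α] {k : ℕ}
    {D : Finset (ι → α)} {X : ι → Finset α}
    (h : IsMDSOn k D X) (hk : 2 < k) (hkι : k ≤ Fintype.card ι) {e e' j : ι} (he : e ≠ e')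
    (hej : e ≠ j) {a a' : α} (ha : a ∈ X e) (ha' : a' ∈ X e) (g g' : α → ℤ)
    (hg : ∀ b, g (Equiv.swap a a' b) = -g b) (b : α) :
    ∑ x ∈ D with x j = b, g (x e) * g' (x e') = 0 := by
  obtain ⟨T, hsub, hT⟩ := Finset.exists_superset_card_eq (s := {e, e', j}) (n := k)
    (Finset.card_le_three.trans hk) hkι
  have heT : e ∈ T := hsub (by simp)
  have heT' : e' ∈ T := hsub (by simp)
  have hjT : j ∈ T := hsub (by simp)
  have key : ∀ x ∈ D, ∃ x' ∈ D, ∀ i ∈ T, x' i = Function.update x e (Equiv.swap a a' (x e)) i := by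
    intro x hx
    obtain ⟨x', hx', -⟩ := h.2 T hT (Function.update x e (Equiv.swap a a' (x e))) (by
      intro i _
      by_cases hi : i = e
      · subst hi
        rw [Function.update_self, Equiv.swap_apply_def]
        split_ifs
        · exact ha'
        · exact ha
        · exact h.1 x hx i
      · rw [Function.update_of_ne hi]
        exact h.1 x hx i)
    exact ⟨x', hx'.1, hx'.2⟩
  choose! τ hτD hτ using key
  have hτe : ∀ x ∈ D, τ x e = Equiv.swap a a' (x e) := fun x hx => by simp [hτ x hx e heT]
  have hτn : ∀ x ∈ D, ∀ i ∈ T, i ≠ e → τ x i = x i := fun x hx i hi hie => by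
    simp [hτ x hx i hi, hie]
  have hneg : ∀ x ∈ D, g (τ x e) * g' (τ x e') = -(g (x e) * g' (x e')) := fun x hx => by
    rw [hτe x hx, hτn x hx e' heT' he.symm, hg]; ring
  refine Finset.sum_involution (fun x _ => τ x) ?_ ?_ ?_ ?_
  · intro x hx
    rw [hneg x (Finset.mem_filter.1 hx).1]; ring
  · intro x hx hne heq
    have := hneg x (Finset.mem_filter.1 hx).1
    rw [heq] at this
    omega
  · intro x hx
    obtain ⟨hxD, hxj⟩ := Finset.mem_filter.1 hx
    exact Finset.mem_filter.2 ⟨hτD x hxD, by rw [hτn x hxD j hjT hej.symm, hxj]⟩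
  · intro x hx
    have hxD := (Finset.mem_filter.1 hx).1
    refine h.eq_of_agree hT.ge (hτD _ (hτD x hxD)) hxD fun i hi => ?_
    by_cases hie : i = e
    · subst hie
      rw [hτe _ (hτD x hxD), hτe x hxD, Equiv.swap_apply_self]
    · rw [hτn _ (hτD x hxD) i hi hie, hτn x hxD i hi hie]

/-- A weight concentrated on two letters in each of two coordinates, whose sums over all words with
one prescribed letter vanish. -/
theorem IsMDSOn.exists_null_weight [Fintype ι] [DecidableEq ι] [DecidableEq α] {k : ℕ}
    {D : Finset (ι → α)} {X : ι → Finset α}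
    (h : IsMDSOn k D X) (hk : 2 < k) (hkι : k ≤ Fintype.card ι) {u s : ι → α} (hu : u ∈ D)
    (hs : ∀ i, s i ∈ X i) (hus : ∀ i, s i ≠ u i) :
    ∃ c : (ι → α) → ℤ, c u = 1 ∧ (∀ x, c x = -1 ∨ c x = 0 ∨ c x = 1) ∧
      ∀ j b, ∑ x ∈ D with x j = b, c x = 0 := by
  obtain ⟨p, q, hpq⟩ := Fintype.one_lt_card_iff.1 (show 1 < Fintype.card ι by omega)
  let g : ι → α → ℤ := fun i a => if a = u i then 1 else if a = s i then -1 else 0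
  have hg : ∀ i b, g i (Equiv.swap (u i) (s i) b) = -g i b := by
    intro i b
    have := hus i
    simp only [g, Equiv.swap_apply_def]
    grind
  refine ⟨fun x => g p (x p) * g q (x q), by simp [g], fun x => ?_, fun j b => ?_⟩
  · simp only [g]
    split_ifs <;> simp
  · by_cases hpj : p = j
    · simp_rw [mul_comm (g p _)]
      exact h.sum_eq_zero hk hkι hpq.symm (by rintro rfl; exact hpq hpj) (h.1 u hu q) (hs q) _ _
        (hg q) b
    · exact h.sum_eq_zero hk hkι hpq hpj (h.1 u hu p) (hs p) _ _ (hg p) b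

theorem prod_zpow_const {β : Type} (s : Finset β) (c : β → ℤ) {a : ℂ} (ha : a ≠ 0) :
    ∏ x ∈ s, a ^ c x = a ^ ∑ x ∈ s, c x := by
  classical
  induction s using Finset.induction_on with
  | empty => simp
  | insert b s hb ih => rw [Finset.prod_insert hb, Finset.sum_insert hb, ih, zpow_add₀ ha]

/-- Weighted products are insensitive to factors depending on single coordinates. -/
theorem prod_zpow_congr_of_null [Fintype ι] [Fintype α] [DecidableEq α] [Nonempty ι]
    {D : Finset (ι → α)} {c : (ι → α) → ℤ}
    (hc : ∀ j b, ∑ x ∈ D with x j = b, c x = 0) {A B : (ι → α) → ℂ} {K : ℂ} (hK : K ≠ 0)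
    {f : ι → α → ℂ} (hf : ∀ x ∈ D, ∀ i, f i (x i) ≠ 0)
    (hAB : ∀ x ∈ D, A x = K * (∏ i, f i (x i)) * B x) :
    ∏ x ∈ D, A x ^ c x = ∏ x ∈ D, B x ^ c x := by
  have h1 : ∏ x ∈ D, K ^ c x = 1 := by
    obtain ⟨j⟩ := ‹Nonempty ι›
    rw [prod_zpow_const D c hK, ← Finset.sum_fiberwise D (fun x => x j) c,
      Finset.sum_eq_zero fun b _ => hc j b, zpow_zero]
  have h2 : ∏ x ∈ D, (∏ i, f i (x i)) ^ c x = 1 := by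
    simp_rw [← Finset.prod_zpow]
    rw [Finset.prod_comm]
    refine Finset.prod_eq_one fun i _ => ?_
    rw [← Finset.prod_fiberwise D (fun x => x i)]
    refine Finset.prod_eq_one fun b _ => ?_
    have : ∏ x ∈ D with x i = b, f i (x i) ^ c x = ∏ x ∈ D with x i = b, f i b ^ c x :=
      Finset.prod_congr rfl fun x hx => by rw [(Finset.mem_filter.1 hx).2]
    rw [this]
    rcases Finset.eq_empty_or_nonempty (D.filter fun x => x i = b) with h0 | ⟨x, hx⟩
    · rw [h0, Finset.prod_empty]
    · obtain ⟨hxD, rfl⟩ := Finset.mem_filter.1 hx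
      rw [prod_zpow_const _ c (hf x hxD i), hc, zpow_zero]
  rw [Finset.prod_congr rfl fun x hx => by rw [hAB x hx, mul_zpow, mul_zpow],
    Finset.prod_mul_distrib, Finset.prod_mul_distrib, h1, h2, one_mul, one_mul]

theorem prod_phase_zpow [DecidableEq (ι → α)] {D : Finset (ι → α)} (c : (ι → α) → ℤ) {w : ι → α}
    (hw : w ∈ D) (e : ℂ) :
    ∏ x ∈ D, (if x = w then e else 1) ^ c x = e ^ c w := by
  rw [Finset.prod_eq_single_of_mem w hw fun x _ hx => by rw [if_neg hx, one_zpow], if_pos rfl]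

/-- If the product of `n` over a `k`-set equals the product over its complement and is minimal
among the products over `k`-sets, then `n` is constant. -/
theorem eq_of_prod_le [Fintype ι] [DecidableEq ι] {k : ℕ} (hN : 2 * k ≤ Fintype.card ι) (n : ι → ℕ)
    (hn : ∀ i, 0 < n i)
    {S : Finset ι} (hS : S.card = k) (heq : ∏ i ∈ S, n i = ∏ i ∈ Sᶜ, n i)
    (hle : ∀ T : Finset ι, T.card = k → ∏ i ∈ S, n i ≤ ∏ i ∈ T, n i) {i j : ι} (hi : i ∈ S)
    (hj : j ∉ S) : n i = n j := by
  have hlow : ∀ a ∈ S, ∀ b ∉ S, n a ≤ n b := by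
    intro a ha b hb
    have h1 := hle (insert b (S.erase a)) (by
      rw [Finset.card_insert_of_notMem (by simp [hb]), Finset.card_erase_add_one ha, hS])
    rw [Finset.prod_insert (by simp [hb]), ← Finset.mul_prod_erase S n ha] at h1
    exact Nat.le_of_mul_le_mul_right h1 (Finset.prod_pos fun i _ => hn i)
  refine (hlow i hi j hj).eq_of_not_lt fun hlt => ?_
  obtain ⟨M, hM, hM'⟩ : ∃ M, (∀ a ∈ S, n a ≤ M) ∧ ∀ b ∉ S, M ≤ n b :=
    ⟨S.sup n, fun a ha => Finset.le_sup ha, fun b hb => Finset.sup_le fun a ha => hlow a ha b hb⟩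
  have hcard : k ≤ Sᶜ.card := by rw [Finset.card_compl, hS]; omega
  obtain ⟨T, hjT, hTS, hT⟩ := Finset.exists_subsuperset_card_eq (s := {j}) (t := Sᶜ) (n := k)
    (by simpa using hj) (by rw [Finset.card_singleton, ← hS]; exact Finset.card_pos.2 ⟨i, hi⟩) hcard
  have hjT : j ∈ T := hjT (by simp)
  have hMpos : 0 < M := (hn i).trans_le (hM i hi)
  have h1 : ∏ a ∈ S.erase i, n a ≤ M ^ (k - 1) := by
    rw [← hS, ← Finset.card_erase_of_mem hi]
    exact Finset.prod_le_pow_card _ _ _ fun a ha => hM a (Finset.mem_of_mem_erase ha)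
  have h2 : M ^ (k - 1) ≤ ∏ a ∈ T.erase j, n a := by
    rw [← hT, ← Finset.card_erase_of_mem hjT]
    exact Finset.pow_card_le_prod _ _ _ fun a ha =>
      hM' a (Finset.mem_compl.1 (hTS (Finset.mem_of_mem_erase ha)))
  have h3 : ∏ a ∈ T, n a ≤ ∏ a ∈ Sᶜ, n a :=
    Finset.prod_le_prod_of_subset_of_one_le' hTS fun a _ _ => hn a
  rw [← heq, ← Finset.mul_prod_erase S n hi, ← Finset.mul_prod_erase T n hjT] at h3
  have h4 : n i * ∏ a ∈ S.erase i, n a ≤ n i * M ^ (k - 1) := Nat.mul_le_mul_left _ h1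
  have h5 : n j * M ^ (k - 1) ≤ n j * ∏ a ∈ T.erase j, n a := Nat.mul_le_mul_left _ h2
  have h6 : n i * M ^ (k - 1) < n j * M ^ (k - 1) :=
    Nat.mul_lt_mul_of_pos_right hlt (pow_pos hMpos _)
  omega

end Combinatorics

theorem exists_row_ne_zero {α : Type} [Fintype α] [DecidableEq α] {M : Matrix α α ℂ}
    (hM : IsUnit M) (a : α) : ∃ b, M a b ≠ 0 := by
  obtain ⟨P, hP⟩ := hM.exists_right_inv
  have h := congrFun (congrFun hP a) a
  rw [Matrix.mul_apply, Matrix.one_apply_eq] at h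
  obtain ⟨b, -, hb⟩ := Finset.exists_ne_zero_of_sum_ne_zero (h.trans_ne one_ne_zero)
  exact ⟨b, left_ne_zero_of_mul hb⟩

theorem exists_col_ne_zero {α : Type} [Fintype α] [DecidableEq α] {M : Matrix α α ℂ}
    (hM : IsUnit M) (b : α) : ∃ a, M a b ≠ 0 :=
  exists_row_ne_zero (M := M.transpose) ((Matrix.isUnit_transpose M).2 hM) b

section Local

variable {ι α : Type}

theorem applyLocal_applyLocal [Fintype ι] [DecidableEq ι] [Fintype α] [DecidableEq α]
    (A B : ι → Matrix α α ℂ) (ψ : (ι → α) → ℂ) :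
    applyLocal A (applyLocal B ψ) = applyLocal (fun i => A i * B i) ψ := by
  funext x
  simp only [applyLocal, Matrix.mul_apply, Finset.mul_sum, Finset.prod_univ_sum,
    Fintype.piFinset_univ, Finset.sum_mul, Finset.prod_mul_distrib]
  rw [Finset.sum_comm]
  simp only [mul_assoc]

theorem applyLocal_smul [Fintype ι] [DecidableEq ι] [Fintype α] [DecidableEq α]
    (A : ι → Matrix α α ℂ) (κ : ℂ) (ψ : (ι → α) → ℂ) :
    applyLocal A (κ • ψ) = κ • applyLocal A ψ := by
  funext x
  simp only [applyLocal, Pi.smul_apply, smul_eq_mul, Finset.mul_sum]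
  exact Finset.sum_congr rfl fun y _ => by ring

theorem applyLocal_one [Fintype ι] [DecidableEq ι] [Fintype α] [DecidableEq α]
    (ψ : (ι → α) → ℂ) : applyLocal (fun _ => 1) ψ = ψ := by
  funext x
  rw [applyLocal, Finset.sum_eq_single x]
  · simp
  · intro y _ hy
    obtain ⟨i, hi⟩ := Function.ne_iff.1 hy
    have h0 : (1 : Matrix α α ℂ) (x i) (y i) = 0 := Matrix.one_apply_ne' hi
    rw [Finset.prod_eq_zero (Finset.mem_univ i) h0, zero_mul]
  · simp

theorem applyLocal_inv [Fintype ι] [DecidableEq ι] [Fintype α] [DecidableEq α]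
    {O : ι → Matrix α α ℂ} (hO : ∀ i, IsUnit (O i)) {κ : ℂ} (hκ : κ ≠ 0)
    {ψ φ : (ι → α) → ℂ} (h : applyLocal O ψ = κ • φ) :
    applyLocal (fun i => (O i)⁻¹) φ = κ⁻¹ • ψ := by
  have h1 := congrArg (applyLocal fun i => (O i)⁻¹) h
  rw [applyLocal_applyLocal, applyLocal_smul] at h1
  simp only [Matrix.nonsing_inv_mul _ ((Matrix.isUnit_iff_isUnit_det _).1 (hO _))] at h1
  rw [applyLocal_one] at h1
  rw [h1, smul_smul, inv_mul_cancel₀ hκ, one_smul]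

/-- Moving the operators outside `S` to the other side of the equation. -/
theorem applyLocal_split [Fintype ι] [DecidableEq ι] [Fintype α] [DecidableEq α]
    {O : ι → Matrix α α ℂ} (hO : ∀ i, IsUnit (O i)) {κ : ℂ}
    {ψ φ : (ι → α) → ℂ} (h : applyLocal O ψ = κ • φ) (S : Finset ι) :
    applyLocal (fun i => if i ∈ Sᶜ then 1 else O i) ψ =
      κ • applyLocal (fun i => if i ∈ S then 1 else (O i)⁻¹) φ := by
  rw [← applyLocal_smul, ← h, applyLocal_applyLocal]
  congr 1
  funext i
  by_cases hi : i ∈ S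
  · simp [hi]
  · simp [hi, Matrix.nonsing_inv_mul _ ((Matrix.isUnit_iff_isUnit_det _).1 (hO i))]

theorem applyLocal_ite_eq_zero [Fintype ι] [DecidableEq ι] [Fintype α] [DecidableEq α]
    {C : Finset (ι → α)} {ψ : (ι → α) → ℂ}
    (hψ : ∀ x, ψ x ≠ 0 ↔ x ∈ C) {T : Finset ι} (M : ι → Matrix α α ℂ) {z : ι → α}
    (hz : ∀ y ∈ C, ∃ i ∈ T, y i ≠ z i) :
    applyLocal (fun i => if i ∈ T then 1 else M i) ψ z = 0 := by
  refine Finset.sum_eq_zero fun y _ => ?_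
  by_cases hy : y ∈ C
  · obtain ⟨i, hi, hne⟩ := hz y hy
    have h0 : (if i ∈ T then 1 else M i) (z i) (y i) = 0 := by
      rw [if_pos hi, Matrix.one_apply_ne' hne]
    rw [Finset.prod_eq_zero (Finset.mem_univ i) h0, zero_mul]
  · rw [not_ne_iff.1 (mt (hψ y).1 hy), mul_zero]

theorem applyLocal_ite_eq [Fintype ι] [DecidableEq ι] [Fintype α] [DecidableEq α] {k : ℕ}
    {C : Finset (ι → α)} {X : ι → Finset α} (hC : IsMDSOn k C X)
    {ψ : (ι → α) → ℂ} (hψ : ∀ x, ψ x ≠ 0 ↔ x ∈ C) {T : Finset ι} (hT : k ≤ T.card)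
    (M : ι → Matrix α α ℂ) {x z : ι → α} (hx : x ∈ C) (hz : ∀ i ∈ T, z i = x i) :
    applyLocal (fun i => if i ∈ T then 1 else M i) ψ z = (∏ i ∈ Tᶜ, M i (z i) (x i)) * ψ x := by
  rw [applyLocal, Finset.sum_eq_single x]
  · rw [← Finset.prod_mul_prod_compl T, Finset.prod_eq_one (s := T), one_mul]
    · congr 1
      exact Finset.prod_congr rfl fun i hi => by rw [if_neg (Finset.mem_compl.1 hi)]
    · intro i hi
      rw [if_pos hi, hz i hi, Matrix.one_apply_eq]
  · intro y _ hyx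
    by_cases hy : y ∈ C
    · have : ∃ i ∈ T, y i ≠ x i := by
        by_contra! hall
        exact hyx (hC.eq_of_agree hT hy hx hall)
      obtain ⟨i, hi, hne⟩ := this
      have h0 : (if i ∈ T then 1 else M i) (z i) (y i) = 0 := by
        rw [if_pos hi, hz i hi, Matrix.one_apply_ne' hne]
      rw [Finset.prod_eq_zero (Finset.mem_univ i) h0, zero_mul]
    · rw [not_ne_iff.1 (mt (hψ y).1 hy), mul_zero]
  · simp

theorem restrict_injOn {k : ℕ} {C D : Finset (ι → α)} {X : ι → Finset α} (hC : IsMDSOn k C X)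
    (hD : D ⊆ C) {T : Finset ι} (hT : k ≤ T.card) :
    Set.InjOn (fun (y : ι → α) (i : T) => y i) D := fun _ hx _ hy hxy =>
  hC.eq_of_agree hT (hD hx) (hD hy) fun i hi => congrFun hxy ⟨i, hi⟩

theorem card_restrict [DecidableEq ι] (T : Finset ι) (X : ι → Finset α) :
    (Fintype.piFinset fun i : T => X i).card = ∏ i ∈ T, (X i).card := by
  rw [Fintype.card_piFinset, Finset.prod_coe_sort T fun i => (X i).card]

theorem card_le_prod [DecidableEq ι] {k : ℕ} {C D : Finset (ι → α)} {Y X : ι → Finset α}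
    (hC : IsMDSOn k C Y)
    (hD : D ⊆ C) (hX : ∀ x ∈ D, ∀ i, x i ∈ X i) {T : Finset ι} (hT : k ≤ T.card) :
    D.card ≤ ∏ i ∈ T, (X i).card := by
  rw [← card_restrict]
  exact Finset.card_le_card_of_injOn _ (fun x hx => by simpa using fun i _ => hX x hx i)
    (restrict_injOn hC hD hT)

theorem prod_le_card [DecidableEq ι] {D : Finset (ι → α)} {X : ι → Finset α} {T : Finset ι}
    (hX : ∀ i, (X i).Nonempty)
    (h : ∀ t : ι → α, (∀ i ∈ T, t i ∈ X i) → ∃ x ∈ D, ∀ i ∈ T, x i = t i) :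
    ∏ i ∈ T, (X i).card ≤ D.card := by
  rw [← card_restrict]
  refine Finset.card_le_card_of_surjOn (fun (y : ι → α) (i : T) => y i) fun t ht => ?_
  have ht' : ∀ i : T, t i ∈ X i := by simpa using ht
  obtain ⟨x, hx, hxt⟩ := h (fun i => if hi : i ∈ T then t ⟨i, hi⟩ else (hX i).choose)
    fun i hi => by simpa [hi] using ht' ⟨i, hi⟩
  exact ⟨x, hx, funext fun i => by simpa using hxt i i.2⟩

theorem exists_of_prod_le_card [DecidableEq ι] {k : ℕ} {C D : Finset (ι → α)} {Y X : ι → Finset α}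
    (hC : IsMDSOn k C Y) (hD : D ⊆ C) (hX : ∀ x ∈ D, ∀ i, x i ∈ X i) {T : Finset ι}
    (hT : k ≤ T.card) (hle : ∏ i ∈ T, (X i).card ≤ D.card) {t : ι → α} (ht : ∀ i ∈ T, t i ∈ X i) :
    ∃ x ∈ D, ∀ i ∈ T, x i = t i := by
  rw [← card_restrict] at hle
  have hmap : Set.MapsTo (fun (y : ι → α) (i : T) => y i) D
      (Fintype.piFinset fun i : T => X i : Finset (T → α)) :=
    fun x hx => by simpa using fun i _ => hX x hx i
  obtain ⟨x, hx, hxt⟩ := Finset.surjOn_of_injOn_of_card_le _ hmap (restrict_injOn hC hD hT) hle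
    (show (fun i : T => t i) ∈ _ by simpa using ht)
  exact ⟨x, hx, fun i hi => congrFun hxt ⟨i, hi⟩⟩

/-- The words that interact with a word `x` under a local equivalence of two states supported on
the same code form a subcode over an alphabet of constant size, on which the first state is a
product function. -/
theorem exists_subcode [Fintype ι] [DecidableEq ι] [Fintype α] [DecidableEq α] {k : ℕ} (hk : 0 < k)
    (hN : 2 * k ≤ Fintype.card ι) {C : Finset (ι → α)}
    (hC : IsMDSOn k C fun _ => Finset.univ) {ψ φ : (ι → α) → ℂ} (hψ : ∀ x, ψ x ≠ 0 ↔ x ∈ C)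
    (hφ : ∀ x, φ x ≠ 0 ↔ x ∈ C) {O : ι → Matrix α α ℂ} (hO : ∀ i, IsUnit (O i)) {κ : ℂ}
    (hκ : κ ≠ 0) (h : applyLocal O ψ = κ • φ) {S : Finset ι} (hS : S.card = k) {x : ι → α}
    (hx : x ∈ C) :
    ∃ (D : Finset (ι → α)) (X : ι → Finset α) (n : ℕ), IsMDSOn k D X ∧ (∀ i, (X i).card = n) ∧
      (∀ i ∈ S, ∀ b, b ∈ X i ↔ O i (x i) b ≠ 0) ∧
      (∀ y ∈ C, (∀ i ∈ S, O i (x i) (y i) ≠ 0) → y ∈ D) ∧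
      ∃ (K : ℂ) (f : ι → α → ℂ), K ≠ 0 ∧
        ∀ y ∈ D, (∀ i, f i (y i) ≠ 0) ∧ ψ y = K * ∏ i, f i (y i) := by
  have hSc : k ≤ Sᶜ.card := by rw [Finset.card_compl, hS]; omega
  have hsplit := fun z => congrFun (applyLocal_split hO h S) z
  have hright : ∀ z, (∀ i ∈ S, z i = x i) →
      applyLocal (fun i => if i ∈ S then 1 else (O i)⁻¹) φ z =
        (∏ i ∈ Sᶜ, (O i)⁻¹ (z i) (x i)) * φ x :=
    fun z hz => applyLocal_ite_eq hC hφ hS.ge _ hx hz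
  have hrel : ∀ y ∈ C, (∏ i ∈ S, O i (x i) (y i)) * ψ y =
      κ * ((∏ i ∈ Sᶜ, (O i)⁻¹ (y i) (x i)) * φ x) := by
    intro y hy
    have h1 := hsplit fun i => if i ∈ S then x i else y i
    rw [Pi.smul_apply, hright _ fun i hi => if_pos hi,
      applyLocal_ite_eq hC hψ hSc _ hy fun i hi => if_neg (Finset.mem_compl.1 hi), compl_compl,
      smul_eq_mul] at h1
    have h2 : ∏ i ∈ S, O i (if i ∈ S then x i else y i) (y i) = ∏ i ∈ S, O i (x i) (y i) :=
      Finset.prod_congr rfl fun i hi => by rw [if_pos hi]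
    have h3 : ∏ i ∈ Sᶜ, (O i)⁻¹ (if i ∈ S then x i else y i) (x i) =
        ∏ i ∈ Sᶜ, (O i)⁻¹ (y i) (x i) :=
      Finset.prod_congr rfl fun i hi => by rw [if_neg (Finset.mem_compl.1 hi)]
    rwa [h2, h3] at h1
  have hext : ∀ t : ι → α, (∀ i ∈ Sᶜ, (O i)⁻¹ (t i) (x i) ≠ 0) → ∃ y ∈ C, ∀ i ∈ Sᶜ, y i = t i := by
    intro t ht
    by_contra! hno
    have h1 := hsplit fun i => if i ∈ S then x i else t i
    rw [Pi.smul_apply, hright _ fun i hi => if_pos hi, applyLocal_ite_eq_zero hψ _ fun y hy => by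
      obtain ⟨i, hi, hne⟩ := hno y hy
      exact ⟨i, hi, by rwa [if_neg (Finset.mem_compl.1 hi)]⟩] at h1
    refine smul_ne_zero hκ (mul_ne_zero (Finset.prod_ne_zero_iff.2 fun i hi => ?_)
      ((hφ x).2 hx)) h1.symm
    rw [if_neg (Finset.mem_compl.1 hi)]
    exact ht i hi
  let X : ι → Finset α := fun i =>
    if i ∈ S then ({b | O i (x i) b ≠ 0} : Finset α) else ({b | (O i)⁻¹ b (x i) ≠ 0} : Finset α)
  have hXS : ∀ i ∈ S, ∀ b, b ∈ X i ↔ O i (x i) b ≠ 0 := fun i hi b => by simp [X, hi]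
  have hXSc : ∀ i ∈ Sᶜ, ∀ b, b ∈ X i ↔ (O i)⁻¹ b (x i) ≠ 0 := fun i hi b => by
    simp [X, Finset.mem_compl.1 hi]
  have hXne : ∀ i, (X i).Nonempty := by
    intro i
    by_cases hi : i ∈ S
    · obtain ⟨b, hb⟩ := exists_row_ne_zero (hO i) (x i)
      exact ⟨b, (hXS i hi b).2 hb⟩
    · obtain ⟨b, hb⟩ := exists_col_ne_zero (Matrix.isUnit_nonsing_inv_iff.2 (hO i)) (x i)
      exact ⟨b, (hXSc i (Finset.mem_compl.2 hi) b).2 hb⟩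
  have hiff : ∀ y ∈ C, (∀ i ∈ S, y i ∈ X i) ↔ ∀ i ∈ Sᶜ, y i ∈ X i := by
    intro y hy
    have h1 := hrel y hy
    have hψy := (hψ y).2 hy
    have hφx := (hφ x).2 hx
    constructor
    · intro hall i hi
      refine (hXSc i hi _).2 (Finset.prod_ne_zero_iff (f := fun i => (O i)⁻¹ (y i) (x i)).1
        (fun h0 => ?_) i hi)
      rw [h0, zero_mul, mul_zero] at h1
      exact mul_ne_zero (Finset.prod_ne_zero_iff.2 fun i hi => (hXS i hi _).1 (hall i hi)) hψy h1
    · intro hall i hi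
      refine (hXS i hi _).2 (Finset.prod_ne_zero_iff (f := fun i => O i (x i) (y i)).1
        (fun h0 => ?_) i hi)
      rw [h0, zero_mul] at h1
      exact mul_ne_zero hκ (mul_ne_zero
        (Finset.prod_ne_zero_iff.2 fun i hi => (hXSc i hi _).1 (hall i hi)) hφx) h1.symm
  let D : Finset (ι → α) := {y ∈ C | ∀ i, y i ∈ X i}
  have hDC : D ⊆ C := Finset.filter_subset _ _
  have hDX : ∀ y ∈ D, ∀ i, y i ∈ X i := fun y hy => (Finset.mem_filter.1 hy).2
  have hDof : ∀ y ∈ C, (∀ i ∈ S, y i ∈ X i) → y ∈ D := by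
    intro y hy hall
    refine Finset.mem_filter.2 ⟨hy, fun i => ?_⟩
    by_cases hi : i ∈ S
    · exact hall i hi
    · exact (hiff y hy).1 hall i (Finset.mem_compl.2 hi)
  have hDS : ∏ i ∈ S, (X i).card = D.card := by
    refine (prod_le_card hXne fun t ht => ?_).antisymm (card_le_prod hC hDC hDX hS.ge)
    obtain ⟨y, ⟨hy, hyt⟩, -⟩ := hC.2 S hS t fun _ _ => Finset.mem_univ _
    exact ⟨y, hDof y hy fun i hi => by rw [hyt i hi]; exact ht i hi, hyt⟩
  have hDSc : ∏ i ∈ Sᶜ, (X i).card = D.card := by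
    refine (prod_le_card hXne fun t ht => ?_).antisymm (card_le_prod hC hDC hDX hSc)
    obtain ⟨y, hy, hyt⟩ := hext t fun i hi => (hXSc i hi _).1 (ht i hi)
    exact ⟨y, hDof y hy ((hiff y hy).2 fun i hi => by rw [hyt i hi]; exact ht i hi), hyt⟩
  have hconst : ∀ i ∈ S, ∀ j ∉ S, (X i).card = (X j).card := fun i hi j hj =>
    eq_of_prod_le hN (fun i => (X i).card) (fun i => (hXne i).card_pos) hS (hDS.trans hDSc.symm)
      (fun T hT => hDS.trans_le (card_le_prod hC hDC hDX hT.ge)) hi hj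
  obtain ⟨p, hp⟩ : S.Nonempty := Finset.card_pos.1 (hS ▸ hk)
  obtain ⟨q, hq⟩ : Sᶜ.Nonempty := Finset.card_pos.1 (hk.trans_le hSc)
  rw [Finset.mem_compl] at hq
  have hn : ∀ i, (X i).card = (X p).card := fun i => by
    by_cases hi : i ∈ S
    · rw [hconst i hi q hq, hconst p hp q hq]
    · exact (hconst p hp i hi).symm
  refine ⟨D, X, (X p).card, ⟨hDX, fun T hT t ht => ?_⟩, hn, hXS,
    fun y hy hall => hDof y hy fun i hi => (hXS i hi _).2 (hall i hi), κ * φ x,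
    fun i b => if i ∈ S then (O i (x i) b)⁻¹ else (O i)⁻¹ b (x i),
    mul_ne_zero hκ ((hφ x).2 hx), fun y hy => ⟨fun i => ?_, ?_⟩⟩
  · have hTD : ∏ i ∈ T, (X i).card ≤ D.card := by
      rw [← hDS]
      simp only [hn, Finset.prod_const, hT, hS, le_refl]
    obtain ⟨y, hy, hyt⟩ := exists_of_prod_le_card hC hDC hDX hT.ge hTD ht
    exact ⟨y, ⟨hy, hyt⟩, fun y' hy' => hC.eq_of_agree hT.ge (hDC hy'.1) (hDC hy) fun i hi => by
      rw [hy'.2 i hi, hyt i hi]⟩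
  · by_cases hi : i ∈ S
    · simpa [hi] using (hXS i hi _).1 (hDX y hy i)
    · simpa [hi] using (hXSc i (Finset.mem_compl.2 hi) _).1 (hDX y hy i)
  · have h1 := hrel y (hDC hy)
    have h2 : ∏ i ∈ S, O i (x i) (y i) ≠ 0 :=
      Finset.prod_ne_zero_iff.2 fun i hi => (hXS i hi _).1 (hDX y hy i)
    rw [← Finset.prod_mul_prod_compl S,
      Finset.prod_congr (g := fun i => (O i (x i) (y i))⁻¹) rfl fun i hi => if_pos hi,
      Finset.prod_congr (s₁ := Sᶜ) (g := fun i => (O i)⁻¹ (y i) (x i)) rfl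
        fun i hi => if_neg (Finset.mem_compl.1 hi), Finset.prod_inv_distrib]
    field_simp
    linear_combination h1

/-- The state supported on `C` with constant coefficient `r`, except for a factor `e` at `w`. -/
noncomputable def phaseState [DecidableEq (ι → α)] (C : Finset (ι → α)) (w : ι → α) (r e : ℂ) :
    (ι → α) → ℂ :=
  fun x => if x ∈ C then r * (if x = w then e else 1) else 0

theorem phaseState_ne_zero_iff [DecidableEq (ι → α)] {C : Finset (ι → α)} {w : ι → α} {r e : ℂ}
    (hr : r ≠ 0)
    (he : e ≠ 0) (x : ι → α) : phaseState C w r e x ≠ 0 ↔ x ∈ C := by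
  unfold phaseState
  split_ifs with h1 h2 <;> simp [hr, he, h1]

/-- If the first phase is nontrivial, a local equivalence of phase states has exactly one nonzero
entry in every row. -/
theorem existsUnique_row_ne_zero [Fintype ι] [DecidableEq ι] [Fintype α] [DecidableEq α] {k : ℕ}
    (hk : 2 < k) (hN : 2 * k ≤ Fintype.card ι)
    {C : Finset (ι → α)} (hC : IsMDSOn k C fun _ => Finset.univ) {w : ι → α} (hw : w ∈ C)
    {r e₁ e₂ : ℂ} (hr : r ≠ 0) (he₁ : e₁ ≠ 0) (he₂ : e₂ ≠ 0) (hne : e₁ ≠ 1)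
    {O : ι → Matrix α α ℂ} (hO : ∀ i, IsUnit (O i)) {κ : ℂ} (hκ : κ ≠ 0)
    (h : applyLocal O (phaseState C w r e₁) = κ • phaseState C w r e₂) (i : ι) (a : α) :
    ∃! b, O i a b ≠ 0 := by
  have hψ := phaseState_ne_zero_iff (C := C) (w := w) hr he₁
  have hφ := phaseState_ne_zero_iff (C := C) (w := w) hr he₂
  have : Nonempty ι := ⟨i⟩
  obtain ⟨S, hiS, hS⟩ := Finset.exists_superset_card_eq (s := {i}) (n := k)
    (by rw [Finset.card_singleton]; omega) (by omega)
  replace hiS : i ∈ S := hiS (by simp)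
  have hword : ∀ t : ι → α, ∃ x ∈ C, ∀ i ∈ S, x i = t i := fun t => by
    obtain ⟨y, ⟨hy, hyt⟩, -⟩ := hC.2 S hS t fun _ _ => Finset.mem_univ _
    exact ⟨y, hy, hyt⟩
  choose t ht using fun i => exists_col_ne_zero (hO i) (w i)
  have hone : ∀ j ∈ S, ∃! b, O j (t j) b ≠ 0 := by
    obtain ⟨x, hx, hxt⟩ := hword t
    obtain ⟨D, X, n, hD, hn, hX, hCD, K, f, hK, hf⟩ :=
      exists_subcode (by omega) hN hC hψ hφ hO hκ h hS hx
    have hwD : w ∈ D := hCD w hw fun j hj => by rw [hxt j hj]; exact ht j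
    intro j hj
    refine ⟨w j, ht j, fun b hb => ?_⟩
    by_contra hbw
    have hn1 : 1 < n := by
      rw [← hn j]
      exact Finset.one_lt_card.2 ⟨b, (hX j hj b).2 (by rwa [hxt j hj]), w j, hD.1 w hwD j, hbw⟩
    have hs : ∀ m, ∃ s ∈ X m, s ≠ w m := fun m =>
      Finset.exists_mem_ne (by rwa [hn m]) (w m)
    choose s hsX hsw using hs
    obtain ⟨c, hcw, -, hc⟩ := hD.exists_null_weight hk (by omega) hwD hsX hsw
    have h1 := prod_zpow_congr_of_null hc (A := fun y => if y = w then e₁ else 1)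
      (B := fun _ => 1) (K := K / r) (div_ne_zero hK hr) (f := f) (fun y hy => (hf y hy).1)
      (fun y hy => by
        have hyψ := (hf y hy).2
        have hyC : y ∈ C := (hψ y).1 (by
          rw [hyψ]
          exact mul_ne_zero hK (Finset.prod_ne_zero_iff.2 fun m _ => (hf y hy).1 m))
        rw [phaseState, if_pos hyC] at hyψ
        field_simp
        linear_combination hyψ)
    rw [prod_phase_zpow c hwD, hcw] at h1
    simp only [zpow_one, one_zpow, Finset.prod_const_one] at h1
    exact hne h1
  obtain ⟨j, hj, hji⟩ := Finset.exists_mem_ne (show 1 < S.card by omega) i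
  obtain ⟨x, hx, hxt⟩ := hword (Function.update t i a)
  obtain ⟨D, X, n, hD, hn, hX, -⟩ := exists_subcode (by omega) hN hC hψ hφ hO hκ h hS hx
  have hcard : ∀ m ∈ S, (∃! b, O m (x m) b ≠ 0) ↔ n = 1 := fun m hm => by
    rw [← hn m, Finset.card_eq_one_iff_existsUnique]
    simp only [hX m hm]
  have h1 := hcard i hiS
  have h2 := hcard j hj
  rw [hxt i hiS, Function.update_self] at h1
  rw [hxt j hj, Function.update_of_ne hji] at h2
  exact h1.2 (h2.1 (hone j hj))

theorem phase_eq_zpow [Fintype ι] [DecidableEq ι] [Fintype α] [DecidableEq α] {k : ℕ} (hk : 2 < k)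
    (hN : 2 * k ≤ Fintype.card ι) [Nontrivial α]
    {C : Finset (ι → α)} (hC : IsMDSOn k C fun _ => Finset.univ) {w : ι → α} (hw : w ∈ C)
    {r e₁ e₂ : ℂ} (hr : r ≠ 0) (he₁ : e₁ ≠ 0) (he₂ : e₂ ≠ 0) (hne : e₁ ≠ 1)
    {O : ι → Matrix α α ℂ} (hO : ∀ i, IsUnit (O i)) {κ : ℂ} (hκ : κ ≠ 0)
    (h : applyLocal O (phaseState C w r e₁) = κ • phaseState C w r e₂) :
    ∃ m : ℤ, (m = -1 ∨ m = 0 ∨ m = 1) ∧ e₁ = e₂ ^ m := by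
  have hψ := phaseState_ne_zero_iff (C := C) (w := w) hr he₁
  have hφ := phaseState_ne_zero_iff (C := C) (w := w) hr he₂
  have : Nonempty ι := Fintype.card_pos_iff.1 (by omega)
  choose σ hσ hσu using
    existsUnique_row_ne_zero hk hN hC hw hr he₁ he₂ hne hO hκ h
  have hσsurj : ∀ i, Function.Surjective (σ i) := fun i b => by
    obtain ⟨a, ha⟩ := exists_col_ne_zero (hO i) b
    exact ⟨a, (hσu i a b ha).symm⟩
  have hσinj : ∀ i, Function.Injective (σ i) := fun i =>
    Finite.injective_iff_surjective.2 (hσsurj i)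
  have happ : ∀ x, (∏ i, O i (x i) (σ i (x i))) * phaseState C w r e₁ (fun i => σ i (x i)) =
      κ * phaseState C w r e₂ x := by
    intro x
    rw [← smul_eq_mul κ, ← Pi.smul_apply, ← h, applyLocal,
      Finset.sum_eq_single fun i => σ i (x i)]
    · intro y _ hy
      obtain ⟨i, hi⟩ := Function.ne_iff.1 hy
      rw [Finset.prod_eq_zero (Finset.mem_univ i) (not_not.1 (mt (hσu i (x i) (y i)) hi)), zero_mul]
    · simp
  have hprod : ∀ x : ι → α, ∏ i, O i (x i) (σ i (x i)) ≠ 0 := fun x =>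
    Finset.prod_ne_zero_iff.2 fun i _ => hσ i (x i)
  choose u hu using fun i => hσsurj i (w i)
  have hmem : ∀ x, x ∈ C ↔ (fun i => σ i (x i)) ∈ C := fun x => by
    rw [← hφ x, ← hψ fun i => σ i (x i), ← mul_ne_zero_iff_left hκ, ← happ x,
      mul_ne_zero_iff_left (hprod x)]
  have huC : u ∈ C := by rw [hmem]; simpa only [hu] using hw
  have hσw : ∀ x : ι → α, (fun i => σ i (x i)) = w ↔ x = u := fun x => by
    constructor
    · intro hx
      funext i
      exact hσinj i (by rw [hu]; exact congrFun hx i)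
    · rintro rfl
      exact funext hu
  choose s hs using fun i => exists_ne (u i)
  obtain ⟨c, hcu, hcs, hc⟩ :=
    hC.exists_null_weight hk (by omega) huC (fun _ => Finset.mem_univ _) hs
  have h1 := prod_zpow_congr_of_null hc (A := fun x => if x = u then e₁ else 1)
    (B := fun x => if x = w then e₂ else 1) (K := κ) hκ
    (f := fun i a => (O i a (σ i a))⁻¹) (fun x _ i => inv_ne_zero (hσ i (x i))) (fun x hx => by
      have hx1 := happ x
      have hp := hprod x
      simp only [phaseState, if_pos hx, if_pos ((hmem x).1 hx), hσw] at hx1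
      rw [Finset.prod_inv_distrib]
      field_simp
      exact mul_left_cancel₀ hr (by linear_combination hx1))
  rw [prod_phase_zpow c huC, prod_phase_zpow c hw, hcu, zpow_one] at h1
  exact ⟨c w, hcs w, h1⟩

end Local

section Uniform

variable {N d k : ℕ}

theorem glue_of_mem (S : Finset (Fin N)) (x : {i // i ∈ S} → Fin d) (z : {i // i ∈ Sᶜ} → Fin d)
    {i : Fin N} (hi : i ∈ S) : glue S x z i = x ⟨i, hi⟩ := dif_pos hi

theorem glue_of_mem_compl (S : Finset (Fin N)) (x : {i // i ∈ S} → Fin d)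
    (z : {i // i ∈ Sᶜ} → Fin d) {i : Fin N} (hi : i ∈ Sᶜ) : glue S x z i = z ⟨i, hi⟩ :=
  dif_neg (Finset.mem_compl.1 hi)

theorem mem_stateSupport {α : Type} [Fintype α] {ψ : α → ℂ} {x : α} :
    x ∈ stateSupport ψ ↔ ψ x ≠ 0 := by
  simp [stateSupport]

/-- The support of a `k`-uniform state of minimal support is an MDS code. -/
theorem IsKUniform.isMDSOn_stateSupport (hd : 0 < d) {ψ : (Fin N → Fin d) → ℂ}
    (hψ : IsKUniform N d k ψ) (hcard : (stateSupport ψ).card = d ^ k) :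
    IsMDSOn k (stateSupport ψ) fun _ => Finset.univ := by
  refine ⟨fun _ _ _ => Finset.mem_univ _, fun T hT t _ => ?_⟩
  have hsurj : Function.Surjective fun (y : stateSupport ψ) (i : T) => (y : Fin N → Fin d) i := by
    intro s
    have h1 := congrFun (congrFun (hψ T hT) s) s
    rw [Matrix.smul_apply, Matrix.one_apply_eq, smul_eq_mul, mul_one] at h1
    have hd' : ((d : ℂ) ^ k)⁻¹ ≠ 0 := inv_ne_zero (pow_ne_zero _ (by exact_mod_cast hd.ne'))
    obtain ⟨z, -, hz⟩ := Finset.exists_ne_zero_of_sum_ne_zero (h1.trans_ne hd')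
    exact ⟨⟨glue T s z, mem_stateSupport.2 (left_ne_zero_of_mul hz)⟩,
      funext fun i => glue_of_mem T s z i.2⟩
  have hbij := (Fintype.bijective_iff_surjective_and_card _).2 ⟨hsurj, by simp [hcard, hT]⟩
  obtain ⟨y, hy⟩ := hsurj fun i => t i
  refine ⟨y, ⟨y.2, fun i hi => congrFun hy ⟨i, hi⟩⟩, fun y' hy' => ?_⟩
  have : (⟨y', hy'.1⟩ : stateSupport ψ) = y :=
    hbij.injective (funext fun i => (hy'.2 i i.2).trans (congrFun hy i).symm)
  rw [← this]

theorem phaseState_mul_conj {C : Finset (Fin N → Fin d)} {w : Fin N → Fin d} {r e : ℂ}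
    (he : e * conj e = 1) (x : Fin N → Fin d) :
    phaseState C w r e x * conj (phaseState C w r e x) = if x ∈ C then r * conj r else 0 := by
  unfold phaseState
  split_ifs
  · rw [map_mul]; linear_combination r * conj r * he
  · simp
  · simp

theorem isKUniform_phaseState (hN : 2 * k ≤ N) {C : Finset (Fin N → Fin d)}
    (hC : IsMDSOn k C fun _ => Finset.univ) (w : Fin N → Fin d) {r e : ℂ}
    (hr : r * conj r = ((d : ℂ) ^ k)⁻¹) (he : e * conj e = 1) :
    IsKUniform N d k (phaseState C w r e) := by
  intro S hS
  ext x y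
  rw [Matrix.smul_apply, smul_eq_mul, ← hr, rdm]
  by_cases hxy : x = y
  · subst hxy
    rw [Matrix.one_apply_eq, mul_one]
    simp_rw [phaseState_mul_conj he]
    obtain ⟨u, ⟨hu, hux⟩, huu⟩ := hC.2 S hS (fun i => if hi : i ∈ S then x ⟨i, hi⟩ else w i)
      fun _ _ => Finset.mem_univ _
    have hglue : glue S x (fun i => u i) = u := by
      funext i
      by_cases hi : i ∈ S
      · rw [glue_of_mem S x _ hi, hux i hi, dif_pos hi]
      · rw [glue_of_mem_compl S x _ (Finset.mem_compl.2 hi)]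
    rw [Finset.sum_eq_single fun i : {i // i ∈ Sᶜ} => u i]
    · rw [hglue, if_pos hu]
    · intro z _ hz
      refine if_neg fun hmem => hz ?_
      have := huu _ ⟨hmem, fun i hi => by rw [glue_of_mem S x z hi, dif_pos hi]⟩
      funext i
      rw [← this, glue_of_mem_compl S x z i.2]
    · simp
  · rw [Matrix.one_apply_ne hxy, mul_zero]
    refine Finset.sum_eq_zero fun z _ => ?_
    by_cases h1 : glue S x z ∈ C
    · by_cases h2 : glue S y z ∈ C
      · refine absurd (funext fun i => ?_) hxy
        have hSc : k ≤ Sᶜ.card := by rw [Finset.card_compl, hS, Fintype.card_fin]; omega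
        have := hC.eq_of_agree hSc h1 h2 fun i hi => by
          rw [glue_of_mem_compl S x z hi, glue_of_mem_compl S y z hi]
        rw [← glue_of_mem S x z i.2, this, glue_of_mem S y z i.2]
      · simp [phaseState, h2]
    · simp [phaseState, h1]

theorem sum_normSq_phaseState {C : Finset (Fin N → Fin d)} (hC : C.card = d ^ k) (hd : 0 < d)
    (w : Fin N → Fin d) {r e : ℂ} (hr : r * conj r = ((d : ℂ) ^ k)⁻¹) (he : e * conj e = 1) :
    ∑ x, Complex.normSq (phaseState C w r e x) = 1 := by
  have hd' : (d : ℂ) ^ k ≠ 0 := pow_ne_zero _ (by exact_mod_cast hd.ne')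
  have : ∑ x, (Complex.normSq (phaseState C w r e x) : ℂ) = 1 := by
    simp_rw [← Complex.mul_conj, phaseState_mul_conj he]
    simp [hC, hr, hd']
  exact_mod_cast this

end Uniform

/-- A nontrivial phase in `[0, π)` is determined by the local equivalence class. -/
theorem phase_eq_of_applyLocal {ι α : Type} [Fintype ι] [DecidableEq ι] [Fintype α]
    [DecidableEq α] [Nontrivial α] {k : ℕ} (hk : 2 < k) (hN : 2 * k ≤ Fintype.card ι)
    {C : Finset (ι → α)} (hC : IsMDSOn k C fun _ => Finset.univ) {w : ι → α} (hw : w ∈ C)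
    {r : ℂ} (hr : r ≠ 0) {θ₁ θ₂ : ℝ} (h₁ : θ₁ ∈ Set.Ico 0 Real.pi) (h₂ : θ₂ ∈ Set.Ico 0 Real.pi)
    (h0 : θ₁ ≠ 0) {O : ι → Matrix α α ℂ} (hO : ∀ i, IsUnit (O i)) {κ : ℂ} (hκ : κ ≠ 0)
    (h : applyLocal O (phaseState C w r (Complex.exp (θ₁ * Complex.I))) =
      κ • phaseState C w r (Complex.exp (θ₂ * Complex.I))) : θ₁ = θ₂ := by
  have hIcc : ∀ {θ : ℝ}, θ ∈ Set.Ico 0 Real.pi → θ ∈ Set.Icc 0 Real.pi :=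
    fun hθ => Set.Ico_subset_Icc_self hθ
  have hcos : Real.cos θ₁ ≠ 1 := fun hc => h0 (Real.injOn_cos (hIcc h₁)
    ⟨le_rfl, Real.pi_pos.le⟩ (hc.trans Real.cos_zero.symm))
  have hre : ∀ θ : ℝ, (Complex.exp (θ * Complex.I)).re = Real.cos θ :=
    Complex.exp_ofReal_mul_I_re
  have hne : Complex.exp (θ₁ * Complex.I) ≠ 1 := fun he => hcos (by rw [← hre, he, Complex.one_re])
  obtain ⟨m, hm, hexp⟩ := phase_eq_zpow hk hN hC hw hr (Complex.exp_ne_zero _)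
    (Complex.exp_ne_zero _) hne hO hκ h
  have h2 := congrArg Complex.re hexp
  rw [hre] at h2
  refine Real.injOn_cos (hIcc h₁) (hIcc h₂) ?_
  rcases hm with rfl | rfl | rfl
  · rw [h2, zpow_neg_one, ← Complex.exp_neg, ← neg_mul, ← Complex.ofReal_neg, hre, Real.cos_neg]
  · exact absurd (by simpa using h2) hcos
  · rw [h2, zpow_one, hre]

/-- Let k > 2, N ≥ 2k, d ≥ 2. If there exists a k-uniform state of N
qudits with d levels having minimal support, then there is a family (ψ_θ)_{θ ∈ [0,π)} of
k-uniform states that are pairwise non-SLOCC-equivalent. -/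
theorem infinitely_many_nonSlocc_kUniform (k N d : ℕ) (hk : 2 < k) (hN : 2 * k ≤ N)
    (hd : 2 ≤ d)
    (hex : ∃ ψ : (Fin N → Fin d) → ℂ,
      (∑ x, Complex.normSq (ψ x)) = 1 ∧ IsKUniform N d k ψ ∧
      (stateSupport ψ).card = d ^ k) :
    ∃ Ψ : ℝ → ((Fin N → Fin d) → ℂ),
      (∀ θ ∈ Set.Ico (0 : ℝ) Real.pi,
        (∑ x, Complex.normSq (Ψ θ x)) = 1 ∧ IsKUniform N d k (Ψ θ)) ∧
      ∀ θ₁ ∈ Set.Ico (0 : ℝ) Real.pi, ∀ θ₂ ∈ Set.Ico (0 : ℝ) Real.pi, θ₁ ≠ θ₂ →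
        ¬ ∃ (O : Fin N → Matrix (Fin d) (Fin d) ℂ) (κ : ℂ),
            (∀ i, IsUnit (O i)) ∧ κ ≠ 0 ∧ applyLocal O (Ψ θ₁) = κ • Ψ θ₂ := by
  obtain ⟨ψ, -, hψ, hcard⟩ := hex
  have hC := hψ.isMDSOn_stateSupport (by omega) hcard
  obtain ⟨w, hw⟩ : (stateSupport ψ).Nonempty :=
    Finset.card_pos.1 (by rw [hcard]; exact pow_pos (by omega) k)
  have : Nontrivial (Fin d) := Fin.nontrivial_iff_two_le.2 hd
  have hN' : 2 * k ≤ Fintype.card (Fin N) := by rwa [Fintype.card_fin]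
  obtain ⟨r, hr⟩ : ∃ r : ℂ, r * conj r = ((d : ℂ) ^ k)⁻¹ := by
    refine ⟨(Real.sqrt ((d : ℝ) ^ k)⁻¹ : ℝ), ?_⟩
    rw [Complex.conj_ofReal, ← Complex.ofReal_mul, Real.mul_self_sqrt (by positivity)]
    push_cast
    rfl
  have hr0 : r ≠ 0 := by
    rintro rfl
    rw [zero_mul] at hr
    exact inv_ne_zero (pow_ne_zero k (Nat.cast_ne_zero.2 (by omega : d ≠ 0))) hr.symm
  have he : ∀ θ : ℝ, Complex.exp (θ * Complex.I) * conj (Complex.exp (θ * Complex.I)) = 1 :=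
    fun θ => by rw
    [Complex.mul_conj, Complex.normSq_eq_norm_sq, Complex.norm_exp_ofReal_mul_I]; simp
  refine ⟨fun θ => phaseState (stateSupport ψ) w r (Complex.exp (θ * Complex.I)),
    fun θ _ => ⟨sum_normSq_phaseState hcard (by omega) w hr (he θ),
      isKUniform_phaseState hN hC w hr (he θ)⟩, ?_⟩
  rintro θ₁ h₁ θ₂ h₂ hne ⟨O, κ, hO, hκ, h⟩
  by_cases h0 : θ₁ = 0
  · exact hne (phase_eq_of_applyLocal hk hN' hC hw hr0 h₂ h₁ (fun h => hne (h0.trans h.symm))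
      (fun i => Matrix.isUnit_nonsing_inv_iff.2 (hO i)) (inv_ne_zero hκ)
      (applyLocal_inv hO hκ h)).symm
  · exact hne (phase_eq_of_applyLocal hk hN' hC hw hr0 h₁ h₂ h0 hO hκ h)
end

section
/- Let E be an SL-invariant polynomial measure of homogeneous degree h ≥ 1 on N qubits, and let ψ be a pure state of N+1 qubits, decomposed as ψ = |0⟩⊗ψ₀ + |1⟩⊗ψ₁ where ψ_b(x) = ψ(b::x) for b ∈ {0,1} and x : Fin N → Fin 2. Then: (1) for any O_2,…,O_{N+1} ∈ SL(2,ℂ) acting on the last N qubits, writing ψ₀′ = (O_2⊗⋯⊗O_{N+1})ψ₀ and ψ₁′ = (O_2⊗⋯⊗O_{N+1})ψ₁, one has E(ζ·ψ₀′ + ψ₁′) = E(ζ·ψ₀ + ψ₁) for every ζ ∈ ℂ; in particular the roots are unchanged; (2) for a matrix [[a,b],[c,d]] ∈ SL(2,ℂ) (ad − bc = 1) acting on the first qubit, i.e. writing ψ₀′ = a·ψ₀ + b·ψ₁ and ψ₁′ = c·ψ₀ + d·ψ₁, if ζ ∈ ℂ satisfies E(ζ·ψ₀ + ψ₁) = 0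 and a − b·ζ ≠ 0, then ζ′ = (d·ζ − c)/(a − b·ζ) satisfies E(ζ′·ψ₀′ + ψ₁′) = 0; that is, the roots transform via the Möbius transformation associated with the inverse operator. -/
/-- The slice ψ_b of an (N+1)-qubit state ψ, defined by ψ_b(x) = ψ(b::x). -/
def qSlice {N : ℕ} (b : Fin 2) (ψ : (Fin (N + 1) → Fin 2) → ℂ) :
    (Fin N → Fin 2) → ℂ := fun x => ψ (Fin.cons b x)

/-- Local operators act linearly. -/
theorem applyLocal_smul_add {ι α : Type} [Fintype ι] [DecidableEq ι] [Fintype α]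
    [DecidableEq α] (O : ι → Matrix α α ℂ) (ζ : ℂ) (v w : (ι → α) → ℂ) :
    applyLocal O (ζ • v + w) = ζ • applyLocal O v + applyLocal O w := by
  ext x
  simp only [applyLocal, Pi.add_apply, Pi.smul_apply, smul_eq_mul, mul_add,
    Finset.sum_add_distrib, Finset.mul_sum]
  congr 1
  exact Finset.sum_congr rfl fun y _ => mul_left_comm _ _ _

/-- Let E be an SL-invariant polynomial measure of homogeneous degree
h ≥ 1 on N qubits and ψ a pure state of N+1 qubits with slices ψ₀, ψ₁. Then
(1) the roots of ζ ↦ E(ζ·ψ₀ + ψ₁) are invariant under SL(2,ℂ) operators acting on the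
last N qubits, and (2) under an SL(2,ℂ) operator [[a,b],[c,d]] acting on the first
qubit, the roots transform via the inverse Möbius transformation
ζ ↦ (d·ζ − c)/(a − b·ζ). -/
theorem slip_roots_transform (N h : ℕ) (hh : 1 ≤ h)
    (E : ((Fin N → Fin 2) → ℂ) → ℂ)
    (hpoly : ∃ P : MvPolynomial (Fin N → Fin 2) ℂ, ∀ v, E v = MvPolynomial.eval v P)
    (hhom : ∀ (κ : ℂ) (v : (Fin N → Fin 2) → ℂ), E (κ • v) = κ ^ h * E v)
    (hinv : ∀ O : Fin N → Matrix (Fin 2) (Fin 2) ℂ, (∀ i, (O i).det = 1) →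
      ∀ v : (Fin N → Fin 2) → ℂ, E (applyLocal O v) = E v)
    (ψ : (Fin (N + 1) → Fin 2) → ℂ) :
    (∀ O : Fin N → Matrix (Fin 2) (Fin 2) ℂ, (∀ i, (O i).det = 1) → ∀ ζ : ℂ,
        E (ζ • applyLocal O (qSlice 0 ψ) + applyLocal O (qSlice 1 ψ)) =
          E (ζ • qSlice 0 ψ + qSlice 1 ψ)) ∧
    (∀ a b c d : ℂ, a * d - b * c = 1 → ∀ ζ : ℂ,
        E (ζ • qSlice 0 ψ + qSlice 1 ψ) = 0 → a - b * ζ ≠ 0 →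
        E (((d * ζ - c) / (a - b * ζ)) • (a • qSlice 0 ψ + b • qSlice 1 ψ) +
            (c • qSlice 0 ψ + d • qSlice 1 ψ)) = 0) := by
  refine ⟨fun O hO ζ => ?_, fun a b c d hdet ζ hζ hne => ?_⟩
  · rw [← applyLocal_smul_add, hinv O hO]
  · have h0 : (d * ζ - c) / (a - b * ζ) * a + c = (a - b * ζ)⁻¹ * ζ := by
      rw [div_mul_eq_mul_div, div_add' _ _ _ hne, inv_mul_eq_div]
      congr 1
      linear_combination ζ * hdet
    have h1 : (d * ζ - c) / (a - b * ζ) * b + d = (a - b * ζ)⁻¹ := by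
      rw [div_mul_eq_mul_div, div_add' _ _ _ hne, inv_eq_one_div]
      congr 1
      linear_combination hdet
    have key : ((d * ζ - c) / (a - b * ζ)) • (a • qSlice 0 ψ + b • qSlice 1 ψ) +
        (c • qSlice 0 ψ + d • qSlice 1 ψ) =
        (a - b * ζ)⁻¹ • (ζ • qSlice 0 ψ + qSlice 1 ψ) := by
      rw [smul_add (a - b * ζ)⁻¹, smul_smul, ← h0, ← h1]
      module
    rw [key, hhom, hζ, mul_zero]
end

section
/- Let z₁, z₂, z₃, z₄ be four pairwise distinct complex numbers. Then there exist a, b, c, d ∈ ℂ with ad − bc ≠ 0 and a complex number z₀ with z₀ ≠ 0 and z₀⁴ ≠ 1 such that c·zᵢ + d ≠ 0 for every i ∈ {1,2,3,4} and the Möbius transformation T(z) = (a·z + b)/(c·z + d) maps the set {z₁, z₂, z₃, z₄} bijectively onto the normal system {z₀, 1/z₀, −z₀, −1/z₀}. -/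
/-- If the zeros of two independent affine forms `a z + b` and `c z + d` are harmonic with respect
to the distinct points `x` and `y`, then neither form vanishes at `x`. -/
theorem affine_forms_ne_zero_of_harmonic {K : Type*} [Field K] {a b c d x y : K}
    (hdet : a * d - b * c ≠ 0) (hxy : x ≠ y)
    (h : (a * x + b) * (c * y + d) + (a * y + b) * (c * x + d) = 0) :
    a * x + b ≠ 0 ∧ c * x + d ≠ 0 := by
  have key : (a * x + b) * (c * y + d) - (a * y + b) * (c * x + d) ≠ 0 := by
    have : (a * x + b) * (c * y + d) - (a * y + b) * (c * x + d)
        = (a * d - b * c) * (x - y) := by ring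
    rw [this]
    exact mul_ne_zero hdet (sub_ne_zero.2 hxy)
  constructor <;> intro h0 <;> apply key <;> rw [h0] at h ⊢ <;> grind

/-- Given two disjoint pairs of points, there are two independent affine forms whose zeros
(one of them possibly at infinity) are harmonic with respect to both pairs. -/
theorem exists_harmonic_affine_forms {x y u v : ℂ}
    (hxu : x ≠ u) (hxv : x ≠ v) (hyu : y ≠ u) (hyv : y ≠ v) :
    ∃ a b c d : ℂ, a * d - b * c ≠ 0 ∧
      (a * x + b) * (c * y + d) + (a * y + b) * (c * x + d) = 0 ∧
      (a * u + b) * (c * v + d) + (a * v + b) * (c * u + d) = 0 := by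
  by_cases hs : x + y = u + v
  · exact ⟨1, -((x + y) / 2), 0, 1, by simp, by ring, by rw [hs]; ring⟩
  have hs' : x + y - (u + v) ≠ 0 := sub_ne_zero.2 hs
  obtain ⟨e, he⟩ : ∃ e : ℂ, e * (x + y - (u + v)) = 2 * (x * y - u * v) :=
    ⟨2 * (x * y - u * v) / (x + y - (u + v)), div_mul_cancel₀ _ hs'⟩
  obtain ⟨r, hr⟩ := IsAlgClosed.exists_pow_nat_eq
    ((e / 2) ^ 2 - (e * (x + y) - 2 * x * y) / 2) (n := 2) two_pos
  have hx : (1 * x + -(e / 2 + r)) * (1 * y + -(e / 2 - r))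
      + (1 * y + -(e / 2 + r)) * (1 * x + -(e / 2 - r)) = 0 := by
    linear_combination -2 * hr
  have hu : (1 * u + -(e / 2 + r)) * (1 * v + -(e / 2 - r))
      + (1 * v + -(e / 2 + r)) * (1 * u + -(e / 2 - r)) = 0 := by
    linear_combination -2 * hr + he
  refine ⟨1, -(e / 2 + r), 1, -(e / 2 - r), ?_, hx, hu⟩
  intro hdet
  obtain rfl : r = 0 := by linear_combination hdet / 2
  have hx' : (x - e / 2) * (y - e / 2) = 0 := by linear_combination hx / 2
  have hu' : (u - e / 2) * (v - e / 2) = 0 := by linear_combination hu / 2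
  simp only [mul_eq_zero, sub_eq_zero] at hx' hu'
  grind

/-- Any four pairwise distinct complex numbers can be mapped by a
Möbius transformation bijectively onto a non-degenerate normal system
{z₀, 1/z₀, −z₀, −1/z₀}. -/
theorem exists_moebius_to_normal_system (z₁ z₂ z₃ z₄ : ℂ)
    (h12 : z₁ ≠ z₂) (h13 : z₁ ≠ z₃) (h14 : z₁ ≠ z₄)
    (h23 : z₂ ≠ z₃) (h24 : z₂ ≠ z₄) (h34 : z₃ ≠ z₄) :
    ∃ a b c d z₀ : ℂ, a * d - b * c ≠ 0 ∧ z₀ ≠ 0 ∧ z₀ ^ 4 ≠ 1 ∧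
      (∀ z ∈ ({z₁, z₂, z₃, z₄} : Set ℂ), c * z + d ≠ 0) ∧
      Set.BijOn (fun z => (a * z + b) / (c * z + d))
        ({z₁, z₂, z₃, z₄} : Set ℂ) ({z₀, 1 / z₀, -z₀, -(1 / z₀)} : Set ℂ) := by
  obtain ⟨a, b, c, d, hdet, h, k⟩ := exists_harmonic_affine_forms h12 h14 h23.symm h34
  obtain ⟨n₁, m₁⟩ := affine_forms_ne_zero_of_harmonic hdet h13 h
  obtain ⟨n₂, m₂⟩ := affine_forms_ne_zero_of_harmonic hdet h24 k
  obtain ⟨-, m₃⟩ := affine_forms_ne_zero_of_harmonic hdet h13.symm (by rwa [add_comm])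
  obtain ⟨-, m₄⟩ := affine_forms_ne_zero_of_harmonic hdet h24.symm (by rwa [add_comm])
  obtain ⟨s, hs⟩ := IsAlgClosed.exists_pow_nat_eq
    ((c * z₁ + d) * (c * z₂ + d) / ((a * z₁ + b) * (a * z₂ + b))) (n := 2) two_pos
  have hs0 : s ≠ 0 := by
    rintro rfl
    have := div_ne_zero (mul_ne_zero m₁ m₂) (mul_ne_zero n₁ n₂)
    exact this (by rw [← hs]; simp)
  rw [eq_div_iff (mul_ne_zero n₁ n₂)] at hs
  have hdet' : s * a * d - s * b * c ≠ 0 := by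
    convert mul_ne_zero hs0 hdet using 1
    ring
  set T : ℂ → ℂ := fun z => (s * a * z + s * b) / (c * z + d) with hT
  have hden : ∀ z ∈ ({z₁, z₂, z₃, z₄} : Set ℂ), c * z + d ≠ 0 := by
    rintro z (rfl | rfl | rfl | rfl) <;> assumption
  have hinj : Set.InjOn T {z₁, z₂, z₃, z₄} := by
    intro x hx y hy hxy
    have hxy' := (div_eq_div_iff (hden x hx) (hden y hy)).1 hxy
    refine sub_eq_zero.1 ((mul_eq_zero.1 ?_).resolve_left hdet')
    linear_combination hxy'
  have hT0 : T z₁ ≠ 0 := by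
    refine div_ne_zero ?_ m₁
    convert mul_ne_zero hs0 n₁ using 1
    ring
  have hT2 : T z₂ = 1 / T z₁ := by
    rw [eq_div_iff hT0]
    simp only [hT]
    rw [div_mul_div_comm, div_eq_one_iff_eq (mul_ne_zero m₂ m₁)]
    linear_combination hs
  have hT3 : T z₃ = -T z₁ := by
    simp only [hT]
    rw [← neg_div, div_eq_div_iff m₃ m₁]
    linear_combination s * h
  have hT4 : T z₄ = -(1 / T z₁) := by
    rw [← hT2]
    simp only [hT]
    rw [← neg_div, div_eq_div_iff m₄ m₂]
    linear_combination s * k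
  refine ⟨s * a, s * b, c, d, T z₁, hdet', hT0, fun h4 => ?_, hden, ?_⟩
  · have h4' : (T z₁ * T z₁ - 1) * (T z₁ * T z₁ + 1) = 0 := by linear_combination h4
    rcases mul_eq_zero.1 h4' with h1 | h1
    · refine h12 (hinj (by simp) (by simp) ?_)
      rw [hT2, eq_div_iff hT0]
      linear_combination h1
    · refine h14 (hinj (by simp) (by simp) ?_)
      rw [hT4, ← neg_div, eq_div_iff hT0]
      linear_combination h1
  · have himage : T '' {z₁, z₂, z₃, z₄} = {T z₁, 1 / T z₁, -T z₁, -(1 / T z₁)} := by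
      simp only [Set.image_insert_eq, Set.image_singleton, hT2, hT3, hT4]
    rw [← himage]
    exact hinj.bijOn_image
end

section
/- Let a, b, c, d ∈ ℂ be such that a², b², c², d² are pairwise distinct, and let a′, b′, c′, d′ ∈ ℂ. Let 𝒢₂₄ be the subgroup of SL(2,ℂ) generated by the three matrices R_x(π/2) = (1/√2)·[[1, −i], [−i, 1]], R_y(π/2) = (1/√2)·[[1, −1], [1, 1]] and R_z(π/2) = [[exp(−iπ/4), 0], [0, exp(iπ/4)]]. If O_1, O_2, O_3, O_4 ∈ SL(2,ℂ) and κ ∈ ℂ, κ ≠ 0, satisfy (O_1⊗O_2⊗O_3⊗O_4)|G_{abcd}⟩ = κ·|G_{a′b′c′d′}⟩, then each O_i belongs to 𝒢₂₄. -/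
/-- The four-qubit state |G_{abcd}⟩. -/
noncomputable def Gstate (a b c d : ℂ) : (Fin 4 → Fin 2) → ℂ := fun x =>
  if x = ![0, 0, 0, 0] ∨ x = ![1, 1, 1, 1] then (a + d) / 2
  else if x = ![0, 0, 1, 1] ∨ x = ![1, 1, 0, 0] then (a - d) / 2
  else if x = ![0, 1, 0, 1] ∨ x = ![1, 0, 1, 0] then (b + c) / 2
  else if x = ![0, 1, 1, 0] ∨ x = ![1, 0, 0, 1] then (b - c) / 2
  else 0

/-- The rotation R_x(π/2) = (1/√2)·[[1, −i], [−i, 1]]. -/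
noncomputable def RxHalfPi : Matrix (Fin 2) (Fin 2) ℂ :=
  ((Real.sqrt 2 : ℂ))⁻¹ • !![1, -Complex.I; -Complex.I, 1]

/-- The rotation R_y(π/2) = (1/√2)·[[1, −1], [1, 1]]. -/
noncomputable def RyHalfPi : Matrix (Fin 2) (Fin 2) ℂ :=
  ((Real.sqrt 2 : ℂ))⁻¹ • !![1, -1; 1, 1]

/-- The rotation R_z(π/2) = [[exp(−iπ/4), 0], [0, exp(iπ/4)]]. -/
noncomputable def RzHalfPi : Matrix (Fin 2) (Fin 2) ℂ :=
  !![Complex.exp (-(Real.pi / 4) * Complex.I), 0; 0, Complex.exp ((Real.pi / 4) * Complex.I)]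

/-- The subgroup 𝒢₂₄ of SL(2,ℂ) generated by R_x(π/2), R_y(π/2), R_z(π/2). -/
noncomputable def G24 : Subgroup (Matrix.SpecialLinearGroup (Fin 2) ℂ) :=
  Subgroup.closure
    { g : Matrix.SpecialLinearGroup (Fin 2) ℂ |
      (g : Matrix (Fin 2) (Fin 2) ℂ) = RxHalfPi ∨
      (g : Matrix (Fin 2) (Fin 2) ℂ) = RyHalfPi ∨
      (g : Matrix (Fin 2) (Fin 2) ℂ) = RzHalfPi }

open Matrix

/-- The nonzero `2 × 2` matrices satisfying this are the scalar multiples of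
the Pauli matrices `1`, `X`, `Y`, `Z`. -/
def IsPauliMultiple (A : Matrix (Fin 2) (Fin 2) ℂ) : Prop :=
  (A 0 1 = 0 ∧ A 1 0 = 0 ∧ A 0 0 ^ 2 = A 1 1 ^ 2) ∨
    (A 0 0 = 0 ∧ A 1 1 = 0 ∧ A 0 1 ^ 2 = A 1 0 ^ 2)

namespace IsPauliMultiple

variable {A B : Matrix (Fin 2) (Fin 2) ℂ}

theorem mul (hA : IsPauliMultiple A) (hB : IsPauliMultiple B) : IsPauliMultiple (A * B) := by
  rcases hA with ⟨h₁, h₂, h₃⟩ | ⟨h₁, h₂, h₃⟩ <;> rcases hB with ⟨k₁, k₂, k₃⟩ | ⟨k₁, k₂, k₃⟩ <;>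
    simp [IsPauliMultiple, mul_apply, Fin.sum_univ_two, mul_pow, h₁, h₂, h₃, k₁, k₂, k₃]

theorem transpose (hA : IsPauliMultiple A) : IsPauliMultiple Aᵀ := by
  rcases hA with ⟨h₁, h₂, h₃⟩ | ⟨h₁, h₂, h₃⟩ <;> simp [IsPauliMultiple, h₁, h₂, h₃]

theorem adjugate (hA : IsPauliMultiple A) : IsPauliMultiple A.adjugate := by
  rcases hA with ⟨h₁, h₂, h₃⟩ | ⟨h₁, h₂, h₃⟩ <;>
    simp [IsPauliMultiple, adjugate_fin_two, h₁, h₂, h₃]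

end IsPauliMultiple

theorem ofReal_sqrt_two_sq : (Real.sqrt 2 : ℂ) ^ 2 = 2 := by
  rw [← Complex.ofReal_pow, Real.sq_sqrt zero_le_two, Complex.ofReal_ofNat]

theorem ofReal_sqrt_two_inv_sq : ((Real.sqrt 2 : ℂ))⁻¹ ^ 2 = 2⁻¹ := by
  rw [inv_pow, ofReal_sqrt_two_sq]

theorem det_RxHalfPi : RxHalfPi.det = 1 := by
  simp only [RxHalfPi, det_smul, det_fin_two_of, Fintype.card_fin, ofReal_sqrt_two_inv_sq]
  linear_combination (-1 / 2 : ℂ) * Complex.I_sq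

theorem det_RyHalfPi : RyHalfPi.det = 1 := by
  simp only [RyHalfPi, det_smul, det_fin_two_of, Fintype.card_fin, ofReal_sqrt_two_inv_sq]
  norm_num

theorem det_RzHalfPi : RzHalfPi.det = 1 := by
  simp [RzHalfPi, ← Complex.exp_add]

theorem isPauliMultiple_of {p q r s : ℂ} :
    IsPauliMultiple !![p, q; r, s] ↔
      (q = 0 ∧ r = 0 ∧ p ^ 2 = s ^ 2) ∨ (p = 0 ∧ s = 0 ∧ q ^ 2 = r ^ 2) := by
  simp [IsPauliMultiple]

theorem RyHalfPi_conj (p q r s : ℂ) :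
    RyHalfPi * !![p, q; r, s] * RyHalfPi.adjugate =
      (2⁻¹ : ℂ) • !![p - q - r + s, p + q - r - s; p - q + r - s, p + q + r + s] := by
  have h := ofReal_sqrt_two_inv_sq
  ext i j
  fin_cases i <;> fin_cases j <;>
    simp [RyHalfPi, adjugate_fin_two, ← h]
  all_goals ring

theorem RxHalfPi_conj (p q r s : ℂ) :
    RxHalfPi * !![p, q; r, s] * RxHalfPi.adjugate =
      (2⁻¹ : ℂ) • !![p + Complex.I * q - Complex.I * r + s, q + r + Complex.I * (p - s);
        q + r - Complex.I * (p - s), p - Complex.I * q + Complex.I * r + s] := by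
  have h := ofReal_sqrt_two_inv_sq
  ext i j
  fin_cases i <;> fin_cases j <;>
    simp [RxHalfPi, adjugate_fin_two, ← h]
  all_goals
    ring_nf
    simp
  ring

theorem isPauliMultiple_conj_RyHalfPi {A : Matrix (Fin 2) (Fin 2) ℂ} (hA : IsPauliMultiple A) :
    IsPauliMultiple (RyHalfPi * A * RyHalfPi.adjugate) := by
  rw [eta_fin_two A, RyHalfPi_conj]
  rcases hA with ⟨h₁, h₂, h₃⟩ | ⟨h₁, h₂, h₃⟩ <;>
    rcases sq_eq_sq_iff_eq_or_eq_neg.mp h₃ with h₃ | h₃ <;>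
    simp [isPauliMultiple_of, h₁, h₂, h₃] <;> ring_nf <;> simp

theorem isPauliMultiple_conj_RxHalfPi {A : Matrix (Fin 2) (Fin 2) ℂ} (hA : IsPauliMultiple A) :
    IsPauliMultiple (RxHalfPi * A * RxHalfPi.adjugate) := by
  rw [eta_fin_two A, RxHalfPi_conj]
  rcases hA with ⟨h₁, h₂, h₃⟩ | ⟨h₁, h₂, h₃⟩ <;>
    rcases sq_eq_sq_iff_eq_or_eq_neg.mp h₃ with h₃ | h₃ <;>
    simp [isPauliMultiple_of, h₁, h₂, h₃] <;> ring_nf <;> simp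

/-- The rotation `R_y(π/2)` as an element of `SL(2,ℂ)`. -/
noncomputable def slRy : Matrix.SpecialLinearGroup (Fin 2) ℂ := ⟨RyHalfPi, det_RyHalfPi⟩

/-- The rotation `R_x(π/2)` as an element of `SL(2,ℂ)`. -/
noncomputable def slRx : Matrix.SpecialLinearGroup (Fin 2) ℂ := ⟨RxHalfPi, det_RxHalfPi⟩

/-- The rotation `R_z(π/2)` as an element of `SL(2,ℂ)`. -/
noncomputable def slRz : Matrix.SpecialLinearGroup (Fin 2) ℂ := ⟨RzHalfPi, det_RzHalfPi⟩

theorem coe_slRy : (slRy : Matrix (Fin 2) (Fin 2) ℂ) = RyHalfPi := rfl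

theorem coe_slRx : (slRx : Matrix (Fin 2) (Fin 2) ℂ) = RxHalfPi := rfl

theorem coe_slRz : (slRz : Matrix (Fin 2) (Fin 2) ℂ) = RzHalfPi := rfl

theorem slRy_mem_G24 : slRy ∈ G24 := Subgroup.subset_closure (Or.inr (Or.inl rfl))

theorem slRx_mem_G24 : slRx ∈ G24 := Subgroup.subset_closure (Or.inl rfl)

theorem slRz_mem_G24 : slRz ∈ G24 := Subgroup.subset_closure (Or.inr (Or.inr rfl))

theorem mem_G24_of_diagonal {U : Matrix.SpecialLinearGroup (Fin 2) ℂ} (h₀₁ : U 0 1 = 0)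
    (h₁₀ : U 1 0 = 0) (h : (U 0 0 ^ 2) ^ 2 = (U 1 1 ^ 2) ^ 2) : U ∈ G24 := by
  have hdet : U 0 0 * U 1 1 = 1 := by
    have := U.det_coe
    rw [det_fin_two] at this
    linear_combination this + U 1 0 * h₀₁
  have hpow : U 1 1 ^ 8 = 1 := by
    linear_combination (-U 1 1 ^ 4) * h + (U 0 0 ^ 3 * U 1 1 ^ 3 + U 0 0 ^ 2 * U 1 1 ^ 2
      + U 0 0 * U 1 1 + 1) * hdet
  obtain ⟨k, -, hk⟩ :=
    (Complex.isPrimitiveRoot_exp 8 (by norm_num)).eq_pow_of_pow_eq_one hpow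
  have hexp : Complex.exp (2 * Real.pi * Complex.I / (8 : ℕ)) =
      Complex.exp (Real.pi / 4 * Complex.I) := by
    congr 1
    push_cast
    ring
  rw [hexp] at hk
  have hU : U = slRz ^ k := by
    have hz : RzHalfPi = diagonal
        ![Complex.exp (-(Real.pi / 4) * Complex.I), Complex.exp (Real.pi / 4 * Complex.I)] := by
      ext i j
      fin_cases i <;> fin_cases j <;> simp [RzHalfPi]
    have h00 : U 0 0 = Complex.exp (-(Real.pi / 4) * Complex.I) ^ k := by
      refine mul_right_cancel₀ (right_ne_zero_of_mul_eq_one hdet) ?_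
      rw [hdet, ← hk, ← mul_pow, ← Complex.exp_add]
      simp
    apply Subtype.ext
    rw [Matrix.SpecialLinearGroup.coe_pow, coe_slRz, hz, diagonal_pow]
    ext i j
    fin_cases i <;> fin_cases j <;> simp [h₀₁, h₁₀, h00, hk]
  rw [hU]
  exact pow_mem slRz_mem_G24 k

/-- The Pauli matrix `X`. -/
def pauliX : Matrix (Fin 2) (Fin 2) ℂ := !![0, 1; 1, 0]

/-- The Pauli matrix `Z`. -/
def pauliZ : Matrix (Fin 2) (Fin 2) ℂ := !![1, 0; 0, -1]

theorem conj_pauliX (U : Matrix (Fin 2) (Fin 2) ℂ) :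
    U * pauliX * U.adjugate = !![U 0 1 * U 1 1 - U 0 0 * U 1 0, U 0 0 ^ 2 - U 0 1 ^ 2;
      U 1 1 ^ 2 - U 1 0 ^ 2, U 0 0 * U 1 0 - U 0 1 * U 1 1] := by
  ext i j
  fin_cases i <;> fin_cases j <;>
    simp [pauliX, adjugate_fin_two, mul_apply, Fin.sum_univ_two] <;> ring

theorem conj_pauliZ (U : Matrix (Fin 2) (Fin 2) ℂ) :
    U * pauliZ * U.adjugate = !![U 0 0 * U 1 1 + U 0 1 * U 1 0, -2 * (U 0 0 * U 0 1);
      2 * (U 1 0 * U 1 1), -(U 0 0 * U 1 1 + U 0 1 * U 1 0)] := by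
  ext i j
  fin_cases i <;> fin_cases j <;>
    simp [pauliZ, adjugate_fin_two, mul_apply, Fin.sum_univ_two] <;> ring

theorem mem_G24_of_antidiagonal {U : Matrix.SpecialLinearGroup (Fin 2) ℂ} (h₀₀ : U 0 0 = 0)
    (h₁₁ : U 1 1 = 0) (h : (U 0 1 ^ 2) ^ 2 = (U 1 0 ^ 2) ^ 2) : U ∈ G24 := by
  have hR : (slRy * slRy * U : Matrix.SpecialLinearGroup (Fin 2) ℂ) =
      !![-U 1 0, -U 1 1; U 0 0, U 0 1] := by
    have h2 : RyHalfPi * RyHalfPi = !![0, -1; 1, 0] := by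
      have h := ofReal_sqrt_two_inv_sq
      ext i j
      fin_cases i <;> fin_cases j <;> simp [RyHalfPi] <;>
        first | linear_combination (2 : ℂ) * h | linear_combination (-2 : ℂ) * h
    rw [Matrix.SpecialLinearGroup.coe_mul, Matrix.SpecialLinearGroup.coe_mul, coe_slRy, h2]
    ext i j
    fin_cases i <;> fin_cases j <;> simp [mul_apply, Fin.sum_univ_two]
  have hmem : slRy * slRy * U ∈ G24 := by
    apply mem_G24_of_diagonal <;> rw [hR] <;> simp [h₀₀, h₁₁, h]
  exact (Subgroup.mul_mem_cancel_left _ (mul_mem slRy_mem_G24 slRy_mem_G24)).mp hmem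

theorem mem_G24_of_conj_pauliX {U : Matrix.SpecialLinearGroup (Fin 2) ℂ}
    (hX : IsPauliMultiple (U * pauliX * (U : Matrix (Fin 2) (Fin 2) ℂ).adjugate))
    (hU : (U 0 1 = 0 ∧ U 1 0 = 0) ∨ (U 0 0 = 0 ∧ U 1 1 = 0)) : U ∈ G24 := by
  have hdet := U.det_coe
  rw [det_fin_two] at hdet
  rw [conj_pauliX, isPauliMultiple_of] at hX
  rcases hU with ⟨h₁, h₂⟩ | ⟨h₁, h₂⟩ <;> simp only [h₁, h₂] at hX hdet
  · refine mem_G24_of_diagonal h₁ h₂ ?_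
    rcases hX with ⟨h, -⟩ | ⟨-, -, h⟩
    · simp_all
    · linear_combination h
  · refine mem_G24_of_antidiagonal h₁ h₂ ?_
    rcases hX with ⟨h, -⟩ | ⟨-, -, h⟩
    · simp_all
    · linear_combination h

/-- An element of `SL(2,ℂ)` normalizing the Pauli group up to scalars lies in `G24`. -/
theorem mem_G24_of_conj_pauli {U : Matrix.SpecialLinearGroup (Fin 2) ℂ}
    (hX : IsPauliMultiple (U * pauliX * (U : Matrix (Fin 2) (Fin 2) ℂ).adjugate))
    (hZ : IsPauliMultiple (U * pauliZ * (U : Matrix (Fin 2) (Fin 2) ℂ).adjugate)) :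
    U ∈ G24 := by
  have hdet := U.det_coe
  rw [det_fin_two] at hdet
  rw [conj_pauliZ, isPauliMultiple_of] at hZ
  rcases hZ with ⟨h₁, h₂, -⟩ | ⟨h₁, -, h₂⟩
  · refine mem_G24_of_conj_pauliX hX ?_
    have h₁ : U 0 0 = 0 ∨ U 0 1 = 0 := by simpa using h₁
    have h₂ : U 1 0 = 0 ∨ U 1 1 = 0 := by simpa using h₂
    rcases h₁ with h₁ | h₁ <;> rcases h₂ with h₂ | h₂ <;> simp_all
  · have hps : U 0 0 * U 1 1 = 1 / 2 := by linear_combination (h₁ + hdet) / 2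
    have hs : U 1 1 ≠ 0 := by
      rintro h
      norm_num [h] at hps
    have hp : U 0 0 ≠ 0 := by
      rintro h
      norm_num [h] at hps
    have h₃ : (U 0 0 * U 0 1) ^ 2 = (U 1 0 * U 1 1) ^ 2 := by linear_combination h₂ / 4
    rcases sq_eq_sq_iff_eq_or_eq_neg.mp h₃ with h | h
    · have hX' := isPauliMultiple_conj_RxHalfPi hX
      have hsq : U 0 0 ^ 2 = (Complex.I * U 1 0) ^ 2 := by
        refine mul_right_cancel₀ hs ?_
        linear_combination U 0 0 * h₁ - U 1 0 * h - U 1 0 ^ 2 * U 1 1 * Complex.I_sq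
      refine (Subgroup.mul_mem_cancel_left _ slRx_mem_G24).mp (mem_G24_of_conj_pauliX ?_ ?_)
      · rw [Matrix.SpecialLinearGroup.coe_mul, coe_slRx, adjugate_mul_distrib]
        simpa only [Matrix.mul_assoc] using hX'
      · have hr : U 1 0 ≠ 0 := by
          rintro h
          simp [h, hp] at hsq
        rw [Matrix.SpecialLinearGroup.coe_mul, coe_slRx, RxHalfPi]
        rcases sq_eq_sq_iff_eq_or_eq_neg.mp hsq with h | h
        · right
          have hq : U 0 1 = -(Complex.I * U 1 1) := by
            refine mul_right_cancel₀ hr ?_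
            linear_combination h₁ - U 1 1 * h
          simp [mul_apply, Fin.sum_univ_two, h, hq]
          exact ⟨by ring, by linear_combination ((Real.sqrt 2 : ℂ)⁻¹ * U 1 1) * Complex.I_sq⟩
        · left
          have hq : U 0 1 = Complex.I * U 1 1 := by
            refine mul_right_cancel₀ hr ?_
            linear_combination h₁ - U 1 1 * h
          simp [mul_apply, Fin.sum_univ_two, h, hq]
          exact ⟨by ring, by linear_combination ((Real.sqrt 2 : ℂ)⁻¹ * U 1 0) * Complex.I_sq⟩
    · have hX' := isPauliMultiple_conj_RyHalfPi hX
      have hsq : U 0 0 ^ 2 = U 1 0 ^ 2 := by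
        refine mul_right_cancel₀ hs ?_
        linear_combination U 0 0 * h₁ - U 1 0 * h
      refine (Subgroup.mul_mem_cancel_left _ slRy_mem_G24).mp (mem_G24_of_conj_pauliX ?_ ?_)
      · rw [Matrix.SpecialLinearGroup.coe_mul, coe_slRy, adjugate_mul_distrib]
        simpa only [Matrix.mul_assoc] using hX'
      · have hr : U 1 0 ≠ 0 := by
          rintro h
          simp [h, hp] at hsq
        rw [Matrix.SpecialLinearGroup.coe_mul, coe_slRy, RyHalfPi]
        rcases sq_eq_sq_iff_eq_or_eq_neg.mp hsq with h | h
        · right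
          have hq : U 0 1 = -U 1 1 := by
            refine mul_right_cancel₀ hr ?_
            linear_combination h₁ - U 1 1 * h
          simp [mul_apply, Fin.sum_univ_two, h, hq]
        · left
          have hq : U 0 1 = U 1 1 := by
            refine mul_right_cancel₀ hr ?_
            linear_combination h₁ - U 1 1 * h
          simp [mul_apply, Fin.sum_univ_two, h, hq]

theorem mul_adjugate_cancel_middle {P A Q B : Matrix (Fin 2) (Fin 2) ℂ} (hQ : Q.det = 1) :
    P * A * Q * (P * B * Q).adjugate = P * (A * B.adjugate) * P.adjugate := by
  have h : Q * Q.adjugate = 1 := by rw [mul_adjugate, hQ, one_smul]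
  calc P * A * Q * (P * B * Q).adjugate
      = P * A * (Q * Q.adjugate) * B.adjugate * P.adjugate := by
        simp only [adjugate_mul_distrib, Matrix.mul_assoc]
    _ = P * (A * B.adjugate) * P.adjugate := by rw [h]; simp only [Matrix.mul_one, Matrix.mul_assoc]

theorem adjugate_mul_cancel_middle {P A Q B : Matrix (Fin 2) (Fin 2) ℂ} (hP : P.det = 1) :
    (P * B * Q).adjugate * (P * A * Q) = Q.adjugate * (B.adjugate * A) * Q := by
  have h : P.adjugate * P = 1 := by rw [adjugate_mul, hP, one_smul]
  calc (P * B * Q).adjugate * (P * A * Q)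
      = Q.adjugate * B.adjugate * (P.adjugate * P) * A * Q := by
        simp only [adjugate_mul_distrib, Matrix.mul_assoc]
    _ = Q.adjugate * (B.adjugate * A) * Q := by rw [h]; simp only [Matrix.mul_one, Matrix.mul_assoc]

theorem mem_G24_of_adjugate_conj_pauli {U : Matrix.SpecialLinearGroup (Fin 2) ℂ}
    (hX : IsPauliMultiple ((U : Matrix (Fin 2) (Fin 2) ℂ).adjugate * pauliX * U))
    (hZ : IsPauliMultiple ((U : Matrix (Fin 2) (Fin 2) ℂ).adjugate * pauliZ * U)) :
    U ∈ G24 := by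
  have hadj : (U : Matrix (Fin 2) (Fin 2) ℂ).adjugate.adjugate = U := by
    simp [adjugate_adjugate]
  refine inv_mem_iff.mp (mem_G24_of_conj_pauli ?_ ?_) <;>
    rwa [Matrix.SpecialLinearGroup.coe_inv, hadj]

/-- If `A ↦ Rᵀ A S` maps the Pauli matrices `1`, `X`, `Z` to multiples of Pauli matrices,
then `R` and `S` lie in `G24`. -/
theorem mem_G24_of_transpose_mul_mul {R S : Matrix.SpecialLinearGroup (Fin 2) ℂ}
    (h1 : IsPauliMultiple ((R : Matrix (Fin 2) (Fin 2) ℂ)ᵀ * 1 * S))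
    (hX : IsPauliMultiple ((R : Matrix (Fin 2) (Fin 2) ℂ)ᵀ * pauliX * S))
    (hZ : IsPauliMultiple ((R : Matrix (Fin 2) (Fin 2) ℂ)ᵀ * pauliZ * S)) :
    R ∈ G24 ∧ S ∈ G24 := by
  have hR : (R : Matrix (Fin 2) (Fin 2) ℂ)ᵀ.det = 1 := by rw [det_transpose, R.det_coe]
  have hXt : pauliXᵀ = pauliX := by
    ext i j
    fin_cases i <;> fin_cases j <;> rfl
  have hZt : pauliZᵀ = pauliZ := by
    ext i j
    fin_cases i <;> fin_cases j <;> rfl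
  constructor
  · have hX' := (hX.mul h1.adjugate).transpose
    have hZ' := (hZ.mul h1.adjugate).transpose
    rw [mul_adjugate_cancel_middle S.det_coe, adjugate_one, Matrix.mul_one, transpose_mul,
      transpose_mul, transpose_transpose, adjugate_transpose, transpose_transpose,
      ← Matrix.mul_assoc] at hX' hZ'
    rw [hXt] at hX'
    rw [hZt] at hZ'
    exact mem_G24_of_adjugate_conj_pauli hX' hZ'
  · have hX' := h1.adjugate.mul hX
    have hZ' := h1.adjugate.mul hZ
    rw [adjugate_mul_cancel_middle hR, adjugate_one, Matrix.one_mul] at hX' hZ'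
    exact mem_G24_of_adjugate_conj_pauli hX' hZ'

/-- The contraction of `Gstate a b c d` against a state of two of the qubits (those with indices
`2, 3`, or equally those with indices `0, 1`), with two-qubit states written as matrices. -/
noncomputable def bellMap (a b c d : ℂ) (Y : Matrix (Fin 2) (Fin 2) ℂ) :
    Matrix (Fin 2) (Fin 2) ℂ :=
  !![(a + d) / 2 * Y 0 0 + (a - d) / 2 * Y 1 1, (b + c) / 2 * Y 0 1 + (b - c) / 2 * Y 1 0;
    (b - c) / 2 * Y 0 1 + (b + c) / 2 * Y 1 0, (a - d) / 2 * Y 0 0 + (a + d) / 2 * Y 1 1]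

theorem bellMap_smul (a b c d μ : ℂ) (Y : Matrix (Fin 2) (Fin 2) ℂ) :
    bellMap a b c d (μ • Y) = μ • bellMap a b c d Y := by
  ext i j
  fin_cases i <;> fin_cases j <;> simp [bellMap] <;> ring

theorem bellMap_one (a b c d : ℂ) : bellMap a b c d 1 = a • 1 := by
  ext i j
  fin_cases i <;> fin_cases j <;> simp [bellMap] <;> ring

theorem bellMap_pauliX (a b c d : ℂ) : bellMap a b c d pauliX = b • pauliX := by
  ext i j
  fin_cases i <;> fin_cases j <;> simp [bellMap, pauliX] <;> ring

theorem bellMap_pauliZ (a b c d : ℂ) : bellMap a b c d pauliZ = d • pauliZ := by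
  ext i j
  fin_cases i <;> fin_cases j <;> simp [bellMap, pauliZ] <;> ring

/-- The cofactor matrix of a `2 × 2` matrix. -/
def cofactor (Y : Matrix (Fin 2) (Fin 2) ℂ) : Matrix (Fin 2) (Fin 2) ℂ := Y.adjugateᵀ

theorem cofactor_mul (A B : Matrix (Fin 2) (Fin 2) ℂ) :
    cofactor (A * B) = cofactor A * cofactor B := by
  rw [cofactor, adjugate_mul_distrib, transpose_mul, cofactor, cofactor]

theorem cofactor_smul (μ : ℂ) (A : Matrix (Fin 2) (Fin 2) ℂ) :
    cofactor (μ • A) = μ • cofactor A := by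
  simp [cofactor, adjugate_smul]

theorem cofactor_cofactor (A : Matrix (Fin 2) (Fin 2) ℂ) : cofactor (cofactor A) = A := by
  simp [cofactor, ← adjugate_transpose, adjugate_adjugate]

theorem transpose_mul_cofactor_mul {P Q : Matrix (Fin 2) (Fin 2) ℂ} (hP : P.det = 1)
    (hQ : Q.det = 1) (A : Matrix (Fin 2) (Fin 2) ℂ) :
    Pᵀ * cofactor (P * A * Qᵀ) * Q = cofactor A := by
  have h₁ : Pᵀ * cofactor P = 1 := by
    rw [cofactor, ← transpose_mul, adjugate_mul, hP, one_smul, transpose_one]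
  have h₂ : cofactor Qᵀ * Q = 1 := by
    rw [cofactor, adjugate_transpose, transpose_transpose, adjugate_mul, hQ, one_smul]
  calc Pᵀ * cofactor (P * A * Qᵀ) * Q = (Pᵀ * cofactor P) * cofactor A * (cofactor Qᵀ * Q) := by
        simp only [cofactor_mul, Matrix.mul_assoc]
    _ = cofactor A := by rw [h₁, h₂, Matrix.one_mul, Matrix.mul_one]

theorem bellMap_cofactor (a b c d : ℂ) (Y : Matrix (Fin 2) (Fin 2) ℂ) :
    bellMap a b c d (cofactor Y) = cofactor (bellMap a b c d Y) := by
  ext i j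
  fin_cases i <;> fin_cases j <;> simp [bellMap, cofactor, adjugate_fin_two] <;> ring

theorem isPauliMultiple_of_bellMap_bellMap {a b c d μ : ℂ}
    (hab : a ^ 2 ≠ b ^ 2) (hac : a ^ 2 ≠ c ^ 2) (had : a ^ 2 ≠ d ^ 2)
    (hbc : b ^ 2 ≠ c ^ 2) (hbd : b ^ 2 ≠ d ^ 2) (hcd : c ^ 2 ≠ d ^ 2)
    {V : Matrix (Fin 2) (Fin 2) ℂ}
    (hV : bellMap a b c d (bellMap a b c d V) = μ • V) : IsPauliMultiple V := by
  have h₀₀ := congr_fun₂ hV 0 0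
  have h₀₁ := congr_fun₂ hV 0 1
  have h₁₀ := congr_fun₂ hV 1 0
  have h₁₁ := congr_fun₂ hV 1 1
  simp only [bellMap, Matrix.smul_apply, smul_eq_mul, of_apply, cons_val', cons_val_zero, cons_val_one,
    cons_val_fin_one] at h₀₀ h₀₁ h₁₀ h₁₁
  have ha : (a ^ 2 - μ) * (V 0 0 + V 1 1) = 0 := by linear_combination h₀₀ + h₁₁
  have hb : (b ^ 2 - μ) * (V 0 1 + V 1 0) = 0 := by linear_combination h₀₁ + h₁₀
  have hc : (c ^ 2 - μ) * (V 0 1 - V 1 0) = 0 := by linear_combination h₀₁ - h₁₀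
  have hd : (d ^ 2 - μ) * (V 0 0 - V 1 1) = 0 := by linear_combination h₀₀ - h₁₁
  simp only [mul_eq_zero, sub_eq_zero] at ha hb hc hd
  have hsum {x y : ℂ} (h₁ : x + y = 0) (h₂ : x = y) : x = 0 ∧ y = 0 := by
    constructor
    · linear_combination (h₁ + h₂) / 2
    · linear_combination (h₁ - h₂) / 2
  by_cases h : a ^ 2 = μ ∨ d ^ 2 = μ
  · have hb' : V 0 1 + V 1 0 = 0 := hb.resolve_left (by grind)
    have hc' : V 0 1 = V 1 0 := hc.resolve_left (by grind)
    obtain ⟨h₁, h₂⟩ := hsum hb' hc'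
    refine Or.inl ⟨h₁, h₂, ?_⟩
    rcases h with h | h
    · rw [hd.resolve_left (by grind)]
    · rw [eq_neg_of_add_eq_zero_left (ha.resolve_left (by grind)), neg_sq]
  · rw [not_or] at h
    obtain ⟨h₁, h₂⟩ := hsum (ha.resolve_left h.1) (hd.resolve_left h.2)
    refine Or.inr ⟨h₁, h₂, ?_⟩
    rcases hb with hb | hb
    · rw [hc.resolve_left (by grind)]
    · rw [eq_neg_of_add_eq_zero_left hb, neg_sq]

theorem bellMap_bellMap_of_intertwining {a b c d a' b' c' d' κ ν : ℂ}
    {P Q R S A : Matrix (Fin 2) (Fin 2) ℂ}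
    (hP : P.det = 1) (hQ : Q.det = 1) (hR : R.det = 1) (hS : S.det = 1)
    (h₁ : ∀ Y, P * bellMap a b c d (Rᵀ * Y * S) * Qᵀ = κ • bellMap a' b' c' d' Y)
    (h₂ : ∀ Y, R * bellMap a b c d (Pᵀ * Y * Q) * Sᵀ = κ • bellMap a' b' c' d' Y)
    (hA : bellMap a' b' c' d' A = ν • A) :
    bellMap a b c d (bellMap a b c d (Rᵀ * A * S)) = (κ * ν) ^ 2 • (Rᵀ * A * S) := by
  have hV : bellMap a b c d (cofactor (bellMap a b c d (Rᵀ * A * S))) =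
      (κ * ν) • bellMap a b c d (Pᵀ * cofactor A * Q) := by
    rw [← transpose_mul_cofactor_mul hP hQ, h₁, hA, smul_smul, cofactor_smul, Matrix.mul_smul,
      Matrix.smul_mul, bellMap_smul]
  have hW : R * cofactor (bellMap a b c d (bellMap a b c d (Rᵀ * A * S))) * Sᵀ =
      (κ * ν) ^ 2 • cofactor A := by
    rw [← bellMap_cofactor, hV, Matrix.mul_smul, Matrix.smul_mul, h₂, bellMap_cofactor, hA,
      cofactor_smul, smul_smul, smul_smul]
    ring_nf
  have h := transpose_mul_cofactor_mul hR hS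
    (cofactor (bellMap a b c d (bellMap a b c d (Rᵀ * A * S))))
  rw [hW, cofactor_cofactor, cofactor_smul, cofactor_cofactor] at h
  rw [← h, Matrix.mul_smul, Matrix.smul_mul]

theorem mem_G24_of_intertwining {a b c d a' b' c' d' κ : ℂ}
    (hab : a ^ 2 ≠ b ^ 2) (hac : a ^ 2 ≠ c ^ 2) (had : a ^ 2 ≠ d ^ 2)
    (hbc : b ^ 2 ≠ c ^ 2) (hbd : b ^ 2 ≠ d ^ 2) (hcd : c ^ 2 ≠ d ^ 2)
    {P Q R S : Matrix.SpecialLinearGroup (Fin 2) ℂ}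
    (h₁ : ∀ Y, (P : Matrix (Fin 2) (Fin 2) ℂ) *
      bellMap a b c d ((R : Matrix (Fin 2) (Fin 2) ℂ)ᵀ * Y * S) *
        (Q : Matrix (Fin 2) (Fin 2) ℂ)ᵀ = κ • bellMap a' b' c' d' Y)
    (h₂ : ∀ Y, (R : Matrix (Fin 2) (Fin 2) ℂ) *
      bellMap a b c d ((P : Matrix (Fin 2) (Fin 2) ℂ)ᵀ * Y * Q) *
        (S : Matrix (Fin 2) (Fin 2) ℂ)ᵀ = κ • bellMap a' b' c' d' Y) :
    R ∈ G24 ∧ S ∈ G24 := by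
  have key {A : Matrix (Fin 2) (Fin 2) ℂ} {ν : ℂ} (hA : bellMap a' b' c' d' A = ν • A) :
      IsPauliMultiple ((R : Matrix (Fin 2) (Fin 2) ℂ)ᵀ * A * S) :=
    isPauliMultiple_of_bellMap_bellMap hab hac had hbc hbd hcd
      (bellMap_bellMap_of_intertwining P.det_coe Q.det_coe R.det_coe S.det_coe h₁ h₂ hA)
  exact mem_G24_of_transpose_mul_mul (key (bellMap_one ..)) (key (bellMap_pauliX ..))
    (key (bellMap_pauliZ ..))

theorem applyLocal_Gstate (O : Fin 4 → Matrix (Fin 2) (Fin 2) ℂ) (a b c d : ℂ)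
    (x : Fin 4 → Fin 2) :
    applyLocal O (Gstate a b c d) x =
      (a + d) / 2 * (O 0 (x 0) 0 * O 1 (x 1) 0 * O 2 (x 2) 0 * O 3 (x 3) 0 +
        O 0 (x 0) 1 * O 1 (x 1) 1 * O 2 (x 2) 1 * O 3 (x 3) 1) +
      (a - d) / 2 * (O 0 (x 0) 0 * O 1 (x 1) 0 * O 2 (x 2) 1 * O 3 (x 3) 1 +
        O 0 (x 0) 1 * O 1 (x 1) 1 * O 2 (x 2) 0 * O 3 (x 3) 0) +
      (b + c) / 2 * (O 0 (x 0) 0 * O 1 (x 1) 1 * O 2 (x 2) 0 * O 3 (x 3) 1 +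
        O 0 (x 0) 1 * O 1 (x 1) 0 * O 2 (x 2) 1 * O 3 (x 3) 0) +
      (b - c) / 2 * (O 0 (x 0) 0 * O 1 (x 1) 1 * O 2 (x 2) 1 * O 3 (x 3) 0 +
        O 0 (x 0) 1 * O 1 (x 1) 0 * O 2 (x 2) 0 * O 3 (x 3) 1) := by
  have hsupp : ∀ y ∉ ({![0, 0, 0, 0], ![1, 1, 1, 1], ![0, 0, 1, 1], ![1, 1, 0, 0], ![0, 1, 0, 1],
      ![1, 0, 1, 0], ![0, 1, 1, 0], ![1, 0, 0, 1]} : Finset (Fin 4 → Fin 2)),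
      (∏ i, O i (x i) (y i)) * Gstate a b c d y = 0 := by
    intro y hy
    simp only [Finset.mem_insert, Finset.mem_singleton, not_or] at hy
    simp [Gstate, hy]
  rw [applyLocal, ← Finset.sum_subset (Finset.subset_univ _) fun y _ => hsupp y]
  simp [Gstate, Fin.prod_univ_four]
  ring

theorem intertwining_of_applyLocal {a b c d a' b' c' d' κ : ℂ}
    {O : Fin 4 → Matrix (Fin 2) (Fin 2) ℂ}
    (h : applyLocal O (Gstate a b c d) = κ • Gstate a' b' c' d')
    (Y : Matrix (Fin 2) (Fin 2) ℂ) :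
    O 0 * bellMap a b c d ((O 2)ᵀ * Y * O 3) * (O 1)ᵀ = κ • bellMap a' b' c' d' Y ∧
      O 2 * bellMap a b c d ((O 0)ᵀ * Y * O 1) * (O 3)ᵀ = κ • bellMap a' b' c' d' Y := by
  have hx (i j k l : Fin 2) := congr_fun h ![i, j, k, l]
  simp only [applyLocal_Gstate] at hx
  constructor
  · ext i j
    have h₀₀ := hx i j 0 0
    have h₀₁ := hx i j 0 1
    have h₁₀ := hx i j 1 0
    have h₁₁ := hx i j 1 1
    fin_cases i <;> fin_cases j <;>
      simp [Gstate, bellMap, mul_apply, Fin.sum_univ_two] at h₀₀ h₀₁ h₁₀ h₁₁ ⊢ <;>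
      linear_combination Y 0 0 * h₀₀ + Y 0 1 * h₀₁ + Y 1 0 * h₁₀ + Y 1 1 * h₁₁
  · ext i j
    have h₀₀ := hx 0 0 i j
    have h₀₁ := hx 0 1 i j
    have h₁₀ := hx 1 0 i j
    have h₁₁ := hx 1 1 i j
    fin_cases i <;> fin_cases j <;>
      simp [Gstate, bellMap, mul_apply, Fin.sum_univ_two] at h₀₀ h₀₁ h₁₀ h₁₁ ⊢ <;>
      linear_combination Y 0 0 * h₀₀ + Y 0 1 * h₀₁ + Y 1 0 * h₁₀ + Y 1 1 * h₁₁

/-- If a², b², c², d² are pairwise distinct and an SL(2,ℂ)⊗⁴ operator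
maps |G_{abcd}⟩ to a nonzero multiple of |G_{a′b′c′d′}⟩, then each local operator
belongs to 𝒢₂₄. -/
theorem slocc_Gabcd_in_G24 (a b c d a' b' c' d' : ℂ)
    (hab : a ^ 2 ≠ b ^ 2) (hac : a ^ 2 ≠ c ^ 2) (had : a ^ 2 ≠ d ^ 2)
    (hbc : b ^ 2 ≠ c ^ 2) (hbd : b ^ 2 ≠ d ^ 2) (hcd : c ^ 2 ≠ d ^ 2)
    (O : Fin 4 → Matrix.SpecialLinearGroup (Fin 2) ℂ) (κ : ℂ) (hκ : κ ≠ 0)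
    (h : applyLocal (fun i => (O i : Matrix (Fin 2) (Fin 2) ℂ)) (Gstate a b c d) =
      κ • Gstate a' b' c' d') :
    ∀ i, O i ∈ G24 := by
  have h₁ := fun Y => (intertwining_of_applyLocal h Y).1
  have h₂ := fun Y => (intertwining_of_applyLocal h Y).2
  have h₂₃ := mem_G24_of_intertwining hab hac had hbc hbd hcd h₁ h₂
  have h₀₁ := mem_G24_of_intertwining hab hac had hbc hbd hcd h₂ h₁
  intro i
  fin_cases i
  exacts [h₀₁.1, h₀₁.2, h₂₃.1, h₂₃.2]
end
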